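/- arXiv:1502.00886 — 2 statements merged into one kernel-verified Lean document; each statement's English description precedes it below -/
import Mathlib

section
/- Interpolation inequalities for parabolic partial Hölder seminorms (Lemma 6.1): Let R ∈ (0,∞), δ ∈ (0,1), and let u be a bounded smooth function on Q_R = (−R²,0)×B_R. Then there is a constant N depending only on d and δ such that: (a) [u]_{t,(1+δ)/2;Q_{R/2}} + max_{i≤d} ( [D_i u]_{t,δ/2;Q_{R/2}} + [D_i u]_{x,δ;Q_{R/2}} ) ≤ N ( max_{i≤d}[D_i u]_{x,δ;Q_R} + [u]_{t,(1+δ)/2;Q_R} ); and (b) [∂_t u]_{t,δ/2;Q_{R/2}} + [∂_t u]_{x,δ;Q_{R/2}} + max_{i,j≤d} ( [D_iD_j u]_{t,δ/2;Q_{R/2}} + [D_iD_j u]_{x,δ;Q_{R/2}} ) ≤ N ( max_{i,j≤d}[D_iD_j u]_{x,δ;Q_R} + [∂_t u]_{t,δ/2;Q_R} + R^{−2−δ} sup_{Q_R}|u| ). -/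
open MeasureTheory Metric Set Filter

noncomputable section

/-- Spatial first-order partial derivative `D_i`. -/
def sd {d : ℕ} (i : Fin d) (v : EuclideanSpace ℝ (Fin d) → ℝ)
    (x : EuclideanSpace ℝ (Fin d)) : ℝ :=
  fderiv ℝ v x (EuclideanSpace.single i 1)

/-- Spatial second-order partial derivative `D_i D_j`. -/
def sd2 {d : ℕ} (i j : Fin d) (v : EuclideanSpace ℝ (Fin d) → ℝ)
    (x : EuclideanSpace ℝ (Fin d)) : ℝ :=
  sd i (fun y => sd j v y) x

/-- Time derivative `∂_t`. -/
def td {d : ℕ} (u : ℝ → EuclideanSpace ℝ (Fin d) → ℝ) (t : ℝ)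
    (x : EuclideanSpace ℝ (Fin d)) : ℝ :=
  deriv (fun s => u s x) t

/-- Parabolic cylinder `Q_ρ = (-ρ², 0) × B_ρ`. -/
def parQ (d : ℕ) (ρ : ℝ) : Set (ℝ × EuclideanSpace ℝ (Fin d)) :=
  Ioo (-(ρ ^ 2)) 0 ×ˢ ball (0 : EuclideanSpace ℝ (Fin d)) ρ

/-- The half space `ℝ^{d+1}_0 = (-∞, 0) × ℝ^d`. -/
def parNeg (d : ℕ) : Set (ℝ × EuclideanSpace ℝ (Fin d)) :=
  Iio (0 : ℝ) ×ˢ (univ : Set (EuclideanSpace ℝ (Fin d)))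

/-- Partial Hölder bound in the first `q` spatial coordinates `x'`. -/
def PHolderXPar (d q : ℕ) (δ : ℝ) (Q : Set (ℝ × EuclideanSpace ℝ (Fin d)))
    (g : ℝ → EuclideanSpace ℝ (Fin d) → ℝ) (K : ℝ) : Prop :=
  ∀ (t : ℝ) (x y : EuclideanSpace ℝ (Fin d)), (t, x) ∈ Q → (t, y) ∈ Q →
    (∀ i : Fin d, q ≤ (i : ℕ) → x i = y i) → |g t x - g t y| ≤ K * dist x y ^ δ

/-- Full spatial Hölder bound. -/
def HolderXPar (d : ℕ) (δ : ℝ) (Q : Set (ℝ × EuclideanSpace ℝ (Fin d)))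
    (g : ℝ → EuclideanSpace ℝ (Fin d) → ℝ) (K : ℝ) : Prop :=
  ∀ (t : ℝ) (x y : EuclideanSpace ℝ (Fin d)), (t, x) ∈ Q → (t, y) ∈ Q →
    |g t x - g t y| ≤ K * dist x y ^ δ

/-- Hölder bound in the time variable `t`, with exponent `γ`. -/
def HolderTPar (d : ℕ) (γ : ℝ) (Q : Set (ℝ × EuclideanSpace ℝ (Fin d)))
    (g : ℝ → EuclideanSpace ℝ (Fin d) → ℝ) (K : ℝ) : Prop :=
  ∀ (t s : ℝ) (x : EuclideanSpace ℝ (Fin d)), (t, x) ∈ Q → (s, x) ∈ Q →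
    |g t x - g s x| ≤ K * |t - s| ^ γ

/-- Classical regularity of parabolic solutions: `u`, `∂_t u`, `Du`, `D²u` exist and are
continuous on `Q`. -/
def ParClassical {d : ℕ} (Q : Set (ℝ × EuclideanSpace ℝ (Fin d)))
    (u : ℝ → EuclideanSpace ℝ (Fin d) → ℝ) : Prop :=
  (∀ z ∈ Q, DifferentiableAt ℝ (fun s => u s z.2) z.1) ∧
  (∀ z ∈ Q, ContDiffAt ℝ 2 (u z.1) z.2) ∧
  ContinuousOn (fun z : ℝ × EuclideanSpace ℝ (Fin d) => u z.1 z.2) Q ∧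
  ContinuousOn (fun z : ℝ × EuclideanSpace ℝ (Fin d) => td u z.1 z.2) Q ∧
  (∀ i : Fin d,
    ContinuousOn (fun z : ℝ × EuclideanSpace ℝ (Fin d) => sd i (u z.1) z.2) Q) ∧
  (∀ i j : Fin d,
    ContinuousOn (fun z : ℝ × EuclideanSpace ℝ (Fin d) => sd2 i j (u z.1) z.2) Q)

/-- Uniform ellipticity with constant `ν` (parabolic, two-sided bound). -/
def UnifEllipticP (d : ℕ) (ν : ℝ)
    (a : Fin d → Fin d → ℝ → EuclideanSpace ℝ (Fin d) → ℝ) : Prop :=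
  ∀ (t : ℝ) (x : EuclideanSpace ℝ (Fin d)) (ξ : Fin d → ℝ),
    ν * ∑ i, ξ i ^ 2 ≤ ∑ i, ∑ j, a i j t x * ξ i * ξ j ∧
      ∑ i, ∑ j, a i j t x * ξ i * ξ j ≤ ν⁻¹ * ∑ i, ξ i ^ 2


lemma dyadic_aux (S : ℝ → ℝ → Prop) (ρ A B γ c : ℝ) (hc : c = 1 - 2 ^ (γ - 1)) (hA : 0 ≤ A)
    (hB : B ≤ A * c)
    (hpos : ∀ r v, S r v → 0 < r) 
    (hstep : ∀ r v, S r v → r < ρ → ∃ v', S (2 * r) v' ∧ |v| ≤ 1 / 2 * |v'| + B * r ^ γ)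
    (hbase : ∀ r v, S r v → ρ ≤ r → |v| ≤ A * r ^ γ) :
    ∀ r v, S r v → |v| ≤ A * r ^ γ := by
  have key : ∀ n : ℕ, ∀ r v, S r v → ρ ≤ 2 ^ n * r → |v| ≤ A * r ^ γ := by
    intro n
    induction n with
    | zero => 
      intro r v h1 h2
      exact hbase r v h1 (by simpa using h2)
    | succ n ih =>
      intro r v h1 h2
      by_cases h3 : ρ ≤ r
      · exact hbase r v h1 h3
      obtain ⟨v', h4, h5⟩ := hstep r v h1 (not_le.mp h3)
      have h6 := ih (2 * r) v' h4 (by rw [pow_succ] at h2; linarith)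
      have hr := hpos r v h1
      rw [Real.mul_rpow (by norm_num) hr.le] at h6
      have h7 : (2 : ℝ) ^ (γ - 1) = 2 ^ γ / 2 := by
        rw [Real.rpow_sub (by norm_num), Real.rpow_one]
      have h8 : 0 ≤ r ^ γ := Real.rpow_nonneg hr.le _
      have h9 : B * r ^ γ ≤ A * c * r ^ γ := by gcongr
      rw [hc, h7] at h9
      nlinarith
  intro r v h
  have hr := hpos r v h
  obtain ⟨n, hn⟩ := pow_unbounded_of_one_lt (ρ / r) (by norm_num : (1 : ℝ) < 2)
  refine key n r v h ?_
  rw [div_lt_iff₀ hr] at hn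
  exact hn.le

section space
variable {d : ℕ} {R : ℝ} {v : EuclideanSpace ℝ (Fin d) → ℝ}

lemma diffAt_of_cd (hv : ContDiffOn ℝ 2 v (ball 0 R)) {x : EuclideanSpace ℝ (Fin d)}
    (hx : x ∈ ball (0 : EuclideanSpace ℝ (Fin d)) R) : DifferentiableAt ℝ v x :=
  (hv.contDiffAt (isOpen_ball.mem_nhds hx)).differentiableAt (by norm_num)

lemma sd_diffAt (hv : ContDiffOn ℝ 2 v (ball 0 R)) {x : EuclideanSpace ℝ (Fin d)}
    (hx : x ∈ ball (0 : EuclideanSpace ℝ (Fin d)) R) (j : Fin d) :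
    DifferentiableAt ℝ (fun y => sd j v y) x := by
  have h := hv.contDiffAt (isOpen_ball.mem_nhds hx)
  have h2 : ContDiffAt ℝ 1 (fderiv ℝ v) x := h.fderiv_right (by norm_num)
  exact (h2.differentiableAt (by norm_num)).clm_apply (differentiableAt_const _)

lemma clm_expand (L : EuclideanSpace ℝ (Fin d) →L[ℝ] ℝ) (e : EuclideanSpace ℝ (Fin d)) :
    L e = ∑ i, e i * L (EuclideanSpace.single i 1) := by
  have h : e = ∑ i, e i • EuclideanSpace.single i (1 : ℝ) := by
    ext k
    simp [Pi.single_apply]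
  conv_lhs => rw [h]
  simp [map_sum]

lemma line_deriv {w : EuclideanSpace ℝ (Fin d) → ℝ} (x e : EuclideanSpace ℝ (Fin d)) (l : ℝ)
    (hw : DifferentiableAt ℝ w (x + l • e)) :
    HasDerivAt (fun l : ℝ => w (x + l • e)) (∑ i, e i * sd i w (x + l • e)) l := by
  have h1 : HasDerivAt (fun l : ℝ => x + l • e) e l := by
    simpa using ((hasDerivAt_id l).smul_const e).const_add x
  have h2 := hw.hasFDerivAt.comp_hasDerivAt l h1
  rw [clm_expand] at h2
  exact h2

lemma line_deriv_i {w : EuclideanSpace ℝ (Fin d) → ℝ} (x : EuclideanSpace ℝ (Fin d)) (i : Fin d)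
    (l : ℝ) (hw : DifferentiableAt ℝ w (x + l • EuclideanSpace.single i (1 : ℝ))) :
    HasDerivAt (fun l : ℝ => w (x + l • EuclideanSpace.single i (1 : ℝ)))
      (sd i w (x + l • EuclideanSpace.single i (1 : ℝ))) l := by
  have h1 : HasDerivAt (fun l : ℝ => x + l • EuclideanSpace.single i (1 : ℝ)) 
      (EuclideanSpace.single i (1 : ℝ)) l := by
    simpa using ((hasDerivAt_id l).smul_const (EuclideanSpace.single i (1 : ℝ))).const_add x
  exact hw.hasFDerivAt.comp_hasDerivAt l h1

/-- one-dimensional mean value theorem in the form used below -/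
lemma mvt_aux (f f' : ℝ → ℝ) (a b : ℝ) (hab : a < b) (h : ∀ l ∈ Icc a b, HasDerivAt f (f' l) l) :
    ∃ l ∈ Ioo a b, f b - f a = f' l * (b - a) := by
  obtain ⟨l, hl, h2⟩ := exists_hasDerivAt_eq_slope f f' hab
    (fun l hl => (h l hl).continuousAt.continuousWithinAt) (fun l hl => h l (Ioo_subset_Icc_self hl))
  refine ⟨l, hl, ?_⟩
  rw [h2]; field_simp [sub_ne_zero.mpr hab.ne']

lemma mem_ball_of (x e : EuclideanSpace ℝ (Fin d)) (h : ‖x‖ + ‖e‖ < R) :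
    x + e ∈ ball (0 : EuclideanSpace ℝ (Fin d)) R := by
  rw [mem_ball_zero_iff]
  exact (norm_add_le _ _).trans_lt h

lemma norm_ls (l : ℝ) (hl : 0 ≤ l) (i : Fin d) :
    ‖l • EuclideanSpace.single i (1 : ℝ)‖ = l := by
  rw [norm_smul]; simp [abs_of_nonneg hl]

/-- first difference -/
lemma first_diff (hv : ContDiffOn ℝ 2 v (ball 0 R)) (x : EuclideanSpace ℝ (Fin d)) (i : Fin d)
    (h : ℝ) (hh : 0 < h) (hx : ‖x‖ + h < R) :
    ∃ l ∈ Ioo 0 h, v (x + h • EuclideanSpace.single i (1 : ℝ)) - v x =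
      sd i v (x + l • EuclideanSpace.single i (1 : ℝ)) * h := by
  obtain ⟨l, hl, h2⟩ := mvt_aux (fun l => v (x + l • EuclideanSpace.single i (1 : ℝ))) _ 0 h hh
    (fun l hl => line_deriv_i x i l (diffAt_of_cd hv (mem_ball_of _ _ (by
      rw [norm_ls l hl.1]; linarith [hl.2]))))
  refine ⟨l, hl, ?_⟩
  simpa using h2

/-- mixed second difference -/
lemma mixed_diff (hv : ContDiffOn ℝ 2 v (ball 0 R)) (x : EuclideanSpace ℝ (Fin d)) (i j : Fin d)
    (h : ℝ) (hh : 0 < h) (hx : ‖x‖ + 2 * h < R) :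
    ∃ y ∈ ball (0 : EuclideanSpace ℝ (Fin d)) R, dist x y ≤ 2 * h ∧
      (v (x + h • EuclideanSpace.single i (1 : ℝ) + h • EuclideanSpace.single j (1 : ℝ))
        - v (x + h • EuclideanSpace.single j (1 : ℝ))) -
      (v (x + h • EuclideanSpace.single i (1 : ℝ)) - v x) = sd2 i j v y * h ^ 2 := by
  obtain ⟨l, hl, h2⟩ := mvt_aux (fun l => v (x + h • EuclideanSpace.single i (1 : ℝ) 
      + l • EuclideanSpace.single j (1 : ℝ)) - v (x + l • EuclideanSpace.single j (1 : ℝ))) 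
      _ 0 h hh
    (fun l hl => (line_deriv_i _ j l (diffAt_of_cd hv (mem_ball_of _ _ (by
      have := norm_add_le x (h • EuclideanSpace.single i (1 : ℝ))
      rw [norm_ls h hh.le] at this
      rw [norm_ls l hl.1]; linarith [hl.2])))).sub 
        (line_deriv_i x j l (diffAt_of_cd hv (mem_ball_of _ _ (by
      rw [norm_ls l hl.1]; linarith [hl.2])))))
  simp only [zero_smul, add_zero, sub_zero] at h2
  have hxl : ‖x + l • EuclideanSpace.single j (1 : ℝ)‖ ≤ ‖x‖ + l := by
    refine (norm_add_le _ _).trans ?_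
    rw [norm_ls l hl.1.le]
  obtain ⟨m, hm, h3⟩ := mvt_aux (fun m => sd j v ((x + l • EuclideanSpace.single j (1 : ℝ)) 
      + m • EuclideanSpace.single i (1 : ℝ))) _ 0 h hh
    (fun m hm => line_deriv_i (w := fun y => sd j v y) _ i m (sd_diffAt hv (mem_ball_of _ _ (by
      rw [norm_ls m hm.1]; linarith [hm.2, hl.2])) j))
  simp only [zero_smul, add_zero, sub_zero] at h3
  refine ⟨_, mem_ball_of (x + l • EuclideanSpace.single j (1 : ℝ)) 
    (m • EuclideanSpace.single i (1 : ℝ)) ?_, ?_, ?_⟩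
  · rw [norm_ls m hm.1.le]; linarith [hm.2, hl.2]
  · rw [dist_comm, dist_eq_norm, show x + l • EuclideanSpace.single j (1 : ℝ) + 
      m • EuclideanSpace.single i (1 : ℝ) - x = l • EuclideanSpace.single j (1 : ℝ) + 
      m • EuclideanSpace.single i (1 : ℝ) by abel]
    refine (norm_add_le _ _).trans ?_
    rw [norm_ls m hm.1.le, norm_ls l hl.1.le]; linarith [hm.2, hl.2]
  · rw [h2, show x + h • EuclideanSpace.single i (1 : ℝ) + l • EuclideanSpace.single j (1 : ℝ) =
      x + l • EuclideanSpace.single j (1 : ℝ) + h • EuclideanSpace.single i (1 : ℝ) by abel, h3]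
    rw [sd2]; ring

/-- second difference along a line -/
lemma line_diff {w : EuclideanSpace ℝ (Fin d) → ℝ} 
    (hv : ContDiffOn ℝ 2 v (ball 0 R)) (hw : ContDiffOn ℝ 2 w (ball 0 R)) 
    (x e : EuclideanSpace ℝ (Fin d)) (ρ C : ℝ) (hρ : ρ ≤ R)
    (hC : ∀ y ∈ ball (0 : EuclideanSpace ℝ (Fin d)) ρ, ∀ i j, |sd2 i j v y - sd2 i j w y| ≤ C)
    (hx : x ∈ ball (0 : EuclideanSpace ℝ (Fin d)) ρ)
    (hxe : x + (2 : ℝ) • e ∈ ball (0 : EuclideanSpace ℝ (Fin d)) ρ) :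
    |((v (x + (2 : ℝ) • e) - w (x + (2 : ℝ) • e)) - (v (x + e) - w (x + e))) 
      - ((v (x + e) - w (x + e)) - (v x - w x))| ≤ d ^ 2 * ‖e‖ ^ 2 * C := by
  have hmem : ∀ l ∈ Icc (0 : ℝ) 2, x + l • e ∈ ball (0 : EuclideanSpace ℝ (Fin d)) ρ := by
    intro l hl
    have := (convex_ball (0 : EuclideanSpace ℝ (Fin d)) ρ).add_smul_mem hx hxe 
      (t := l / 2) ⟨by linarith [hl.1], by linarith [hl.2]⟩
    rwa [smul_smul, show l / 2 * 2 = l by ring] at this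
  have hsub := ball_subset_ball (x := (0 : EuclideanSpace ℝ (Fin d))) hρ
  have hmR : ∀ l ∈ Icc (0 : ℝ) 2, x + l • e ∈ ball (0 : EuclideanSpace ℝ (Fin d)) R := 
    fun l hl => hsub (hmem l hl)
  let φ : ℝ → ℝ := fun l => v (x + l • e) - w (x + l • e)
  let φ' : ℝ → ℝ := fun l => ∑ j, e j * sd j v (x + l • e) - ∑ j, e j * sd j w (x + l • e)
  let φ'' : ℝ → ℝ := fun l => ∑ j, e j * (∑ i, e i * sd2 i j v (x + l • e)) 
    - ∑ j, e j * (∑ i, e i * sd2 i j w (x + l • e))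
  have h1 : ∀ l ∈ Icc (0 : ℝ) 2, HasDerivAt φ (φ' l) l := fun l hl =>
    (line_deriv x e l (diffAt_of_cd hv (hmR l hl))).sub 
      (line_deriv x e l (diffAt_of_cd hw (hmR l hl)))
  have h2 : ∀ l ∈ Icc (0 : ℝ) 2, HasDerivAt φ' (φ'' l) l := by
    intro l hl
    refine HasDerivAt.sub (HasDerivAt.fun_sum fun j _ => ?_) (HasDerivAt.fun_sum fun j _ => ?_)
    · exact (line_deriv (w := fun y => sd j v y) x e l (sd_diffAt hv (hmR l hl) j)).const_mul _
    · exact (line_deriv (w := fun y => sd j w y) x e l (sd_diffAt hw (hmR l hl) j)).const_mul _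
  obtain ⟨l, hl, h3⟩ := mvt_aux (fun l => φ (l + 1) - φ l) (fun l => φ' (l + 1) - φ' l) 0 1 
    one_pos (fun l hl => by
      refine HasDerivAt.sub ?_ (h1 l ⟨hl.1, by linarith [hl.2]⟩)
      exact (h1 (l + 1) ⟨by linarith [hl.1], by linarith [hl.2]⟩).comp_add_const l 1)
  obtain ⟨m, hm, h4⟩ := mvt_aux φ' φ'' l (l + 1) (by linarith) 
    (fun k hk => h2 k ⟨by linarith [hk.1, hl.1], by linarith [hk.2, hl.2]⟩)
  have h5 : ((v (x + (2 : ℝ) • e) - w (x + (2 : ℝ) • e)) - (v (x + e) - w (x + e))) 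
      - ((v (x + e) - w (x + e)) - (v x - w x)) = φ'' m := by
    have h6 : φ (1 + 1) - φ 1 - (φ (0 + 1) - φ 0) = φ'' m := by
      rw [h3, h4]; ring
    rw [← h6]
    simp only [φ, one_add_one_eq_two, zero_add, one_smul, zero_smul, add_zero]
  rw [h5]
  have hy := hC _ (hmem m ⟨by linarith [hm.1, hl.1], by linarith [hm.2, hl.2]⟩)
  have h7 : φ'' m = ∑ j, ∑ i, e j * e i * (sd2 i j v (x + m • e) - sd2 i j w (x + m • e)) := by
    simp only [φ'', Finset.mul_sum, ← Finset.sum_sub_distrib]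
    refine Finset.sum_congr rfl fun j _ => Finset.sum_congr rfl fun i _ => by ring
  rw [h7]
  have hei : ∀ i, |e i| ≤ ‖e‖ := fun i => by
    have := PiLp.norm_apply_le e i
    rwa [Real.norm_eq_abs] at this
  calc _ ≤ ∑ j : Fin d, ∑ i : Fin d, ‖e‖ * ‖e‖ * C := by
        refine (Finset.abs_sum_le_sum_abs _ _).trans (Finset.sum_le_sum fun j _ => ?_)
        refine (Finset.abs_sum_le_sum_abs _ _).trans (Finset.sum_le_sum fun i _ => ?_)
        rw [abs_mul, abs_mul]
        gcongr
        · exact hei j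
        · exact hei i
        · exact hy i j
    _ = _ := by simp; ring

end space

/-- time: second difference -/
lemma time_second (f : ℝ → ℝ) (a b γ K p T : ℝ) (hγ : 0 ≤ γ) (hK : 0 ≤ K) (hT : 0 < T)
    (hf : ∀ t ∈ Ioo a b, DifferentiableAt ℝ f t) 
    (hH : ∀ t ∈ Ioo a b, ∀ s ∈ Ioo a b, |deriv f t - deriv f s| ≤ K * |t - s| ^ γ)
    (hp : p ∈ Ioo a b) (hq : p + 2 * T ∈ Ioo a b) :
    |(f (p + 2 * T) - f (p + T)) - (f (p + T) - f p)| ≤ T * (K * (2 * T) ^ γ) := by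
  obtain ⟨l, hl, h1⟩ := mvt_aux f (deriv f) p (p + T) (by linarith) (fun l hl => 
    (hf l ⟨by linarith [hl.1, hp.1], by linarith [hl.2, hq.2]⟩).hasDerivAt)
  obtain ⟨m, hm, h2⟩ := mvt_aux f (deriv f) (p + T) (p + 2 * T) (by linarith) (fun l hl => 
    (hf l ⟨by linarith [hl.1, hp.1], by linarith [hl.2, hq.2]⟩).hasDerivAt)
  rw [h1, h2, show deriv f m * (p + 2 * T - (p + T)) - deriv f l * (p + T - p) = 
    T * (deriv f m - deriv f l) by ring, abs_mul, abs_of_pos hT]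
  have h3 := hH m ⟨by linarith [hm.1, hp.1], by linarith [hm.2, hq.2]⟩ l 
    ⟨by linarith [hl.1, hp.1], by linarith [hl.2, hq.2]⟩
  have h4 : |m - l| ≤ 2 * T := by rw [abs_le]; constructor <;> linarith [hm.1, hm.2, hl.1, hl.2]
  have h5 : |m - l| ^ γ ≤ (2 * T) ^ γ := Real.rpow_le_rpow (abs_nonneg _) h4 hγ
  gcongr
  exact h3.trans (by gcongr)

/-- time: difference quotient -/
lemma time_quot (f : ℝ → ℝ) (a b γ K t τ : ℝ) (hγ : 0 ≤ γ) (hK : 0 ≤ K) (hτ : 0 < τ)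
    (hf : ∀ t ∈ Ioo a b, DifferentiableAt ℝ f t) 
    (hH : ∀ t ∈ Ioo a b, ∀ s ∈ Ioo a b, |deriv f t - deriv f s| ≤ K * |t - s| ^ γ)
    (hp : t ∈ Ioo a b) (hq : t - τ ∈ Ioo a b) :
    |deriv f t - (f t - f (t - τ)) / τ| ≤ K * τ ^ γ := by
  obtain ⟨l, hl, h1⟩ := mvt_aux f (deriv f) (t - τ) t (by linarith) (fun l hl => 
    (hf l ⟨by linarith [hl.1, hq.1], by linarith [hl.2, hp.2]⟩).hasDerivAt)
  rw [h1, show deriv f l * (t - (t - τ)) / τ = deriv f l by field_simp; ring]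
  refine (hH t hp l ⟨by linarith [hl.1, hq.1], by linarith [hl.2, hp.2]⟩).trans ?_
  have h4 : |t - l| ≤ τ := by rw [abs_le]; constructor <;> linarith [hl.1, hl.2]
  gcongr

section main
variable {d : ℕ} {R δ : ℝ} {u : ℝ → EuclideanSpace ℝ (Fin d) → ℝ}

lemma parQ_open (d : ℕ) (R : ℝ) : IsOpen (parQ d R) := isOpen_Ioo.prod isOpen_ball

lemma slice_x (hu : ContDiffOn ℝ (⊤ : ℕ∞)
      (fun z : ℝ × EuclideanSpace ℝ (Fin d) => u z.1 z.2) (parQ d R)) 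
    {t : ℝ} (ht : t ∈ Ioo (-(R ^ 2)) 0) : ContDiffOn ℝ 2 (u t) (ball 0 R) := by
  have h2 : ContDiffOn ℝ 2 (fun z : ℝ × EuclideanSpace ℝ (Fin d) => u z.1 z.2) (parQ d R) :=
    hu.of_le (WithTop.coe_le_coe.mpr (le_top : (2 : ℕ∞) ≤ ⊤))
  exact h2.comp (f := fun x : EuclideanSpace ℝ (Fin d) => ((t, x) : ℝ × EuclideanSpace ℝ (Fin d))) 
    (contDiff_const.prodMk contDiff_id).contDiffOn (fun x hx => ⟨ht, hx⟩)

lemma slice_t (hu : ContDiffOn ℝ (⊤ : ℕ∞)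
      (fun z : ℝ × EuclideanSpace ℝ (Fin d) => u z.1 z.2) (parQ d R)) 
    {x : EuclideanSpace ℝ (Fin d)} (hx : x ∈ ball (0 : EuclideanSpace ℝ (Fin d)) R)
    (t : ℝ) (ht : t ∈ Ioo (-(R ^ 2)) 0) : DifferentiableAt ℝ (fun s => u s x) t := by
  have h1 := (hu.contDiffAt ((parQ_open d R).mem_nhds (x := (t, x)) ⟨ht, hx⟩)).differentiableAt 
    (by simp)
  exact h1.comp (f := fun s : ℝ => ((s, x) : ℝ × EuclideanSpace ℝ (Fin d))) t 
    (differentiableAt_id.prodMk (differentiableAt_const _))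

lemma sqrt_rpow_aux (T δ : ℝ) (hT : 0 ≤ T) : (√T) ^ δ = T ^ (δ / 2) := by
  rw [Real.sqrt_eq_rpow, ← Real.rpow_mul hT]; congr 1; ring

lemma part_a_time (hδ : δ ∈ Ioo (0 : ℝ) 1) (hu : ContDiffOn ℝ (⊤ : ℕ∞)
      (fun z : ℝ × EuclideanSpace ℝ (Fin d) => u z.1 z.2) (parQ d R)) (hR : 0 < R)
    (K₁ K₂ : ℝ) (hK₁ : 0 ≤ K₁) (hK₂ : 0 ≤ K₂) (i : Fin d)
    (h1 : HolderXPar d δ (parQ d R) (fun t x => sd i (u t) x) K₁)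
    (h2 : HolderTPar d ((1 + δ) / 2) (parQ d R) u K₂) :
    HolderTPar d (δ/2) (parQ d (R/2)) (fun t x => sd i (u t) x) (2 * (K₁ + K₂)) := by
  intro t s x ht hs
  obtain ⟨ht, hx⟩ := ht
  obtain ⟨hs, -⟩ := hs
  simp only at ht hs hx
  have hx' := mem_ball_zero_iff.mp hx
  by_cases hts : t = s
  · subst hts
    simp only [sub_self, abs_zero]
    have := Real.rpow_nonneg (le_refl (0 : ℝ)) (δ / 2)
    positivity
  have hT : 0 < |t - s| := abs_pos.mpr (sub_ne_zero.mpr hts)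
  set T := |t - s| with hTdef
  have hTR : T < (R / 2) ^ 2 := by 
    rw [hTdef, abs_lt]; constructor <;> linarith [ht.1, ht.2, hs.1, hs.2]
  set h := √T with hh
  have hpos : 0 < h := Real.sqrt_pos.mpr hT
  have hhR : h < R / 2 := by rw [hh, Real.sqrt_lt' (by linarith)]; exact hTR
  have hRR : (R / 2) ^ 2 ≤ R ^ 2 := by nlinarith
  have ht' : t ∈ Ioo (-(R ^ 2)) 0 := ⟨by linarith [ht.1], ht.2⟩
  have hs' : s ∈ Ioo (-(R ^ 2)) 0 := ⟨by linarith [hs.1], hs.2⟩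
  have hxR : x ∈ ball (0 : EuclideanSpace ℝ (Fin d)) R := 
    mem_ball_zero_iff.mpr (by linarith)
  have hyR : x + h • EuclideanSpace.single i (1 : ℝ) ∈ 
    ball (0 : EuclideanSpace ℝ (Fin d)) R := mem_ball_of _ _ (by rw [norm_ls h hpos.le]; linarith)
  have key : ∀ τ ∈ Ioo (-(R ^ 2)) 0, 
      |sd i (u τ) x * h - (u τ (x + h • EuclideanSpace.single i (1 : ℝ)) - u τ x)| 
        ≤ K₁ * h ^ δ * h := by
    intro τ hτ
    obtain ⟨l, hl, h3⟩ := first_diff (slice_x hu hτ) x i h hpos (by linarith)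
    rw [h3, ← sub_mul, abs_mul, abs_of_pos hpos]
    have h4 := h1 τ x (x + l • EuclideanSpace.single i (1 : ℝ)) ⟨hτ, hxR⟩ ⟨hτ, mem_ball_of _ _ 
      (by rw [norm_ls l hl.1.le]; linarith [hl.2])⟩
    rw [dist_self_add_right, norm_ls l hl.1.le] at h4
    have h5 : l ^ δ ≤ h ^ δ := Real.rpow_le_rpow hl.1.le hl.2.le hδ.1.le
    gcongr
    exact h4.trans (by gcongr)
  have k1 := key t ht'
  have k2 := key s hs'
  have k3 := h2 t s x ⟨ht', hxR⟩ ⟨hs', hxR⟩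
  have k4 := h2 t s _ ⟨ht', hyR⟩ ⟨hs', hyR⟩
  have e1 : T ^ ((1 + δ) / 2) = h ^ δ * h := by
    rw [← sqrt_rpow_aux _ _ hT.le, ← hh, Real.rpow_add hpos, Real.rpow_one]; ring
  rw [← hTdef, e1] at k3 k4
  rw [← sqrt_rpow_aux _ _ hT.le, ← hh]
  refine le_of_mul_le_mul_right ?_ hpos
  rw [← abs_of_pos hpos, ← abs_mul, abs_of_pos hpos]
  simp only [abs_le] at *
  constructor <;> linarith [k1.1, k1.2, k2.1, k2.2, k3.1, k3.2, k4.1, k4.2]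

lemma sd2_approx {v : EuclideanSpace ℝ (Fin d) → ℝ} (hδ : 0 ≤ δ) 
    (hv : ContDiffOn ℝ 2 v (ball 0 R)) (x : EuclideanSpace ℝ (Fin d)) (i j : Fin d)
    (K h : ℝ) (hK : 0 ≤ K) (hh : 0 < h) (hx : ‖x‖ + 2 * h < R)
    (hH : ∀ x ∈ ball (0 : EuclideanSpace ℝ (Fin d)) R, 
      ∀ y ∈ ball (0 : EuclideanSpace ℝ (Fin d)) R, 
        |sd2 i j v x - sd2 i j v y| ≤ K * dist x y ^ δ) :
    |sd2 i j v x * h ^ 2 - ((v (x + h • EuclideanSpace.single i (1 : ℝ) + 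
        h • EuclideanSpace.single j (1 : ℝ)) - v (x + h • EuclideanSpace.single j (1 : ℝ))) -
      (v (x + h • EuclideanSpace.single i (1 : ℝ)) - v x))| ≤ K * (2 * h) ^ δ * h ^ 2 := by
  obtain ⟨y, hy, hxy, h1⟩ := mixed_diff hv x i j h hh hx
  rw [h1, ← sub_mul, abs_mul, abs_of_pos (by positivity : 0 < h ^ 2)]
  have h2 := hH x (mem_ball_zero_iff.mpr (by linarith)) y hy
  have h3 : dist x y ^ δ ≤ (2 * h) ^ δ := Real.rpow_le_rpow dist_nonneg hxy hδ
  gcongr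
  exact h2.trans (by gcongr)

lemma c_aux (γ : ℝ) (hγ : γ < 1) : 0 < 1 - (2 : ℝ) ^ (γ - 1) ∧ 1 - (2 : ℝ) ^ (γ - 1) < 1 := by
  have := Real.rpow_lt_one_of_one_lt_of_neg (x := 2) (z := γ - 1) (by norm_num) (by linarith)
  have h2 : (0 : ℝ) < 2 ^ (γ - 1) := by positivity
  constructor <;> linarith

lemma rpow_mul_le (k T γ : ℝ) (hk : 1 ≤ k) (hT : 0 ≤ T) (hγ : γ ≤ 1) : 
    (k * T) ^ γ ≤ k * T ^ γ := by
  rw [Real.mul_rpow (by linarith) hT]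
  gcongr
  calc k ^ γ ≤ k ^ (1 : ℝ) := Real.rpow_le_rpow_of_exponent_le hk hγ
    _ = k := Real.rpow_one k

lemma R_aux (hR : 0 < R) (M : ℝ) : R ^ δ * (R ^ (-(2 + δ)) * M) * R ^ 2 = M := by
  have : R ^ δ * R ^ (-(2 + δ)) * R ^ 2 = 1 := by
    rw [← Real.rpow_natCast, ← Real.rpow_add hR, ← Real.rpow_add hR]
    rw [show δ + -(2 + δ) + ((2 : ℕ) : ℝ) = 0 by push_cast; ring, Real.rpow_zero]
  calc _ = (R ^ δ * R ^ (-(2 + δ)) * R ^ 2) * M := by ring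
    _ = M := by rw [this, one_mul]

lemma part_b_time (hδ : δ ∈ Ioo (0 : ℝ) 1) (hu : ContDiffOn ℝ (⊤ : ℕ∞)
      (fun z : ℝ × EuclideanSpace ℝ (Fin d) => u z.1 z.2) (parQ d R)) (hR : 0 < R)
    (K₁ K₂ M : ℝ) (hK₁ : 0 ≤ K₁) (hK₂ : 0 ≤ K₂) (hM : 0 ≤ M) (i j : Fin d)
    (h1 : HolderXPar d δ (parQ d R) (fun t x => sd2 i j (u t) x) K₁)
    (h2 : HolderTPar d (δ / 2) (parQ d R) (td u) K₂)
    (h3 : ∀ z ∈ parQ d R, |u z.1 z.2| ≤ M)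
    (x : EuclideanSpace ℝ (Fin d)) (hx : ‖x‖ < 3 / 4 * R) (t s : ℝ) 
    (ht : t ∈ Ioo (-(R ^ 2)) 0) (hs : s ∈ Ioo (-(R ^ 2)) 0) :
    |sd2 i j (u t) x - sd2 i j (u s) x| ≤ 
      (2400 / (1 - 2 ^ (δ / 2 - 1)) * (K₁ + K₂ + R ^ (-(2 + δ)) * M)) * |t - s| ^ (δ / 2) := by
  obtain ⟨hc0, hc1⟩ := c_aux (δ / 2) (by linarith [hδ.2])
  set c : ℝ := 1 - 2 ^ (δ / 2 - 1) with hc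
  set K := K₁ + K₂ + R ^ (-(2 + δ)) * M with hK
  have hM' : 0 ≤ R ^ (-(2 + δ)) * M := mul_nonneg (Real.rpow_nonneg hR.le _) hM
  have hK0 : 0 ≤ K := by positivity
  have hxR : x ∈ ball (0 : EuclideanSpace ℝ (Fin d)) R := mem_ball_zero_iff.mpr (by linarith)
  have hA : 0 ≤ 2400 / c * K := by positivity
  have h2400 : 2400 ≤ 2400 / c := by rw [le_div_iff₀ hc0]; linarith
  -- abbreviations
  let Δ : ℝ → ℝ → ℝ := fun h τ => (u τ (x + h • EuclideanSpace.single i (1 : ℝ) + 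
        h • EuclideanSpace.single j (1 : ℝ)) - u τ (x + h • EuclideanSpace.single j (1 : ℝ))) -
      (u τ (x + h • EuclideanSpace.single i (1 : ℝ)) - u τ x)
  have happ : ∀ h τ, 0 < h → 2 * h ≤ R / 4 → τ ∈ Ioo (-(R ^ 2)) 0 → 
      |sd2 i j (u τ) x * h ^ 2 - Δ h τ| ≤ K₁ * (2 * h) ^ δ * h ^ 2 := by
    intro h τ hh hhR hτ
    exact sd2_approx hδ.1.le (slice_x hu hτ) x i j K₁ h hK₁ hh (by linarith) 
      (fun y hy z hz => h1 τ y z ⟨hτ, hy⟩ ⟨hτ, hz⟩)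
  have hmem : ∀ h, 0 < h → 2 * h ≤ R / 4 → 
      (x + h • EuclideanSpace.single i (1 : ℝ) + h • EuclideanSpace.single j (1 : ℝ)) 
        ∈ ball (0 : EuclideanSpace ℝ (Fin d)) R ∧ 
      (x + h • EuclideanSpace.single j (1 : ℝ)) ∈ ball (0 : EuclideanSpace ℝ (Fin d)) R ∧ 
      (x + h • EuclideanSpace.single i (1 : ℝ)) ∈ ball (0 : EuclideanSpace ℝ (Fin d)) R := by
    intro h hh hhR
    refine ⟨mem_ball_of _ _ ?_, mem_ball_of _ _ ?_, mem_ball_of _ _ ?_⟩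
    · have := norm_add_le x (h • EuclideanSpace.single i (1 : ℝ))
      rw [norm_ls h hh.le] at this ⊢
      linarith
    · rw [norm_ls h hh.le]; linarith
    · rw [norm_ls h hh.le]; linarith
  -- sup bound
  have hsup : ∀ τ ∈ Ioo (-(R ^ 2)) 0, |sd2 i j (u τ) x| ≤ 400 * (K * R ^ δ) := by
    intro τ hτ
    have hh : 0 < R / 10 := by linarith
    have k1 := happ (R / 10) τ hh (by linarith) hτ
    obtain ⟨m1, m2, m3⟩ := hmem (R / 10) hh (by linarith)
    have b1 := h3 (τ, _) ⟨hτ, m1⟩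
    have b2 := h3 (τ, _) ⟨hτ, m2⟩
    have b3 := h3 (τ, _) ⟨hτ, m3⟩
    have b4 := h3 (τ, _) ⟨hτ, hxR⟩
    have b5 : |Δ (R / 10) τ| ≤ 4 * M := by
      simp only [Δ]
      simp only [abs_le] at b1 b2 b3 b4 ⊢
      constructor <;> linarith [b1.1, b1.2, b2.1, b2.2, b3.1, b3.2, b4.1, b4.2]
    have b6 : (2 * (R / 10)) ^ δ ≤ R ^ δ := 
      Real.rpow_le_rpow (by linarith) (by linarith) hδ.1.le
    have b7 : K₁ * (2 * (R / 10)) ^ δ * (R / 10) ^ 2 ≤ K₁ * R ^ δ * (R / 10) ^ 2 := by gcongr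
    have b8 : |sd2 i j (u τ) x * (R / 10) ^ 2| ≤ K₁ * R ^ δ * (R / 10) ^ 2 + 4 * M := by
      rw [abs_le] at *
      constructor <;> linarith [k1.1, k1.2, b5.1, b5.2]
    rw [abs_mul, abs_of_pos (by positivity : 0 < (R / 10) ^ 2)] at b8
    refine le_of_mul_le_mul_right (b8.trans ?_) (by positivity : 0 < (R / 10) ^ 2)
    have b9 := R_aux (δ := δ) hR M
    have b10 : 400 * (K * R ^ δ) * (R / 10) ^ 2 = 4 * (R ^ δ * (R ^ (-(2 + δ)) * M) * R ^ 2) + 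
       400 * ((K₁ + K₂) * R ^ δ * (R / 10) ^ 2) := by
      rw [hK]; ring
    rw [b10, b9]
    have b11 : 0 ≤ K₂ * R ^ δ * (R / 10) ^ 2 := by positivity
    have b12 : 0 ≤ K₁ * R ^ δ * (R / 10) ^ 2 := by positivity
    linarith
  -- step estimate
  have hstep : ∀ p T, 0 < T → p ∈ Ioo (-(R ^ 2)) 0 → p + 2 * T ∈ Ioo (-(R ^ 2)) 0 →
      |sd2 i j (u (p + T)) x - sd2 i j (u p) x| ≤ 
        1 / 2 * |sd2 i j (u (p + 2 * T)) x - sd2 i j (u p) x| + 256 * K * T ^ (δ / 2) ∧ 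
      |sd2 i j (u (p + 2 * T)) x - sd2 i j (u (p + T)) x| ≤ 
        1 / 2 * |sd2 i j (u (p + 2 * T)) x - sd2 i j (u p) x| + 256 * K * T ^ (δ / 2) := by
    intro p T hT hp hq
    have hm : p + T ∈ Ioo (-(R ^ 2)) 0 := ⟨by linarith [hp.1], by linarith [hq.2]⟩
    have hTR : T < R ^ 2 := by linarith [hp.1, hq.2]
    have hsT : √T < R := by rw [Real.sqrt_lt' hR]; exact hTR
    have hsT0 : 0 < √T := Real.sqrt_pos.mpr hT
    obtain ⟨h, hh⟩ : ∃ h, h = √T / 8 := ⟨_, rfl⟩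
    have hh0 : 0 < h := by rw [hh]; linarith
    have hhR : 2 * h ≤ R / 4 := by rw [hh]; linarith
    have hTh : T = 64 * h ^ 2 := by 
      rw [hh, div_pow, Real.sq_sqrt hT.le]; ring
    obtain ⟨m1, m2, m3⟩ := hmem h hh0 hhR
    have k0 := happ h p hh0 hhR hp
    have k1 := happ h _ hh0 hhR hm
    have k2 := happ h _ hh0 hhR hq
    have hE : K₁ * (2 * h) ^ δ * h ^ 2 ≤ K₁ * T ^ (δ / 2) * h ^ 2 := by
      rw [← sqrt_rpow_aux T δ hT.le]
      have : (2 * h) ^ δ ≤ √T ^ δ := Real.rpow_le_rpow (by linarith) (by rw [hh]; linarith) hδ.1.le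
      gcongr
    have hts : ∀ y ∈ ball (0 : EuclideanSpace ℝ (Fin d)) R, 
        |(u (p + 2 * T) y - u (p + T) y) - (u (p + T) y - u p y)| ≤ 
          128 * (K₂ * T ^ (δ / 2) * h ^ 2) := by
      intro y hy
      refine (time_second (fun τ => u τ y) (-(R ^ 2)) 0 (δ / 2) K₂ p T (by linarith [hδ.1]) hK₂ hT 
        (slice_t hu hy) (fun t ht s hs => h2 t s y ⟨ht, hy⟩ ⟨hs, hy⟩) hp hq).trans ?_
      have := rpow_mul_le 2 T (δ / 2) (by norm_num) hT.le (by linarith [hδ.2])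
      calc T * (K₂ * (2 * T) ^ (δ / 2)) ≤ T * (K₂ * (2 * T ^ (δ / 2))) := by gcongr
        _ = 128 * (K₂ * T ^ (δ / 2) * h ^ 2) := by 
          generalize T ^ (δ / 2) = w
          rw [hTh]; ring
    have s1 := hts _ m1
    have s2 := hts _ m2
    have s3 := hts _ m3
    have s4 := hts _ hxR
    have hh2 : 0 < h ^ 2 := by positivity
    have hS : |(sd2 i j (u (p + 2 * T)) x - sd2 i j (u (p + T)) x) - 
        (sd2 i j (u (p + T)) x - sd2 i j (u p) x)| ≤ 512 * K * T ^ (δ / 2) := by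
      refine le_of_mul_le_mul_right ?_ hh2
      rw [← abs_of_pos hh2, ← abs_mul, abs_of_pos hh2]
      have hKK : 512 * (K₂ * T ^ (δ / 2) * h ^ 2) + 4 * (K₁ * T ^ (δ / 2) * h ^ 2) ≤ 
          512 * K * T ^ (δ / 2) * h ^ 2 := by
        have : 512 * K * T ^ (δ / 2) * h ^ 2 = 512 * (K₂ * T ^ (δ / 2) * h ^ 2) + 
          512 * (K₁ * T ^ (δ / 2) * h ^ 2) + 512 * (R ^ (-(2 + δ)) * M * T ^ (δ / 2) * h ^ 2) := by
          rw [hK]; ring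
        have : 0 ≤ K₁ * T ^ (δ / 2) * h ^ 2 := by positivity
        have : 0 ≤ R ^ (-(2 + δ)) * M * T ^ (δ / 2) * h ^ 2 := by positivity
        linarith
      refine le_trans ?_ hKK
      simp only [Δ] at k0 k1 k2
      rw [abs_le] at *
      constructor <;> linarith [k0.1, k0.2, k1.1, k1.2, k2.1, k2.2, s1.1, s1.2, s2.1, s2.2, s3.1, 
        s3.2, s4.1, s4.2]
    generalize sd2 i j (u (p + 2 * T)) x = a at *
    generalize sd2 i j (u (p + T)) x = b at *
    generalize sd2 i j (u p) x = e at *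
    have h7 := le_abs_self (a - e)
    have h8 := neg_abs_le (a - e)
    rw [abs_le] at hS
    constructor <;> rw [abs_le] <;> constructor <;> linarith [hS.1, hS.2]
  -- dyadic
  have main := dyadic_aux (fun r v => 0 < r ∧ ∃ p, p ∈ Ioo (-(R ^ 2)) 0 ∧ p + r ∈ Ioo (-(R ^ 2)) 0 
      ∧ v = sd2 i j (u (p + r)) x - sd2 i j (u p) x) (R ^ 2 / 3) (2400 / c * K) (256 * K) 
      (δ / 2) c hc hA (by rw [div_mul_eq_mul_div, div_mul_cancel₀ _ hc0.ne']; linarith) 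
      (fun r v h => h.1) ?_ ?_
  · rcases lt_trichotomy t s with hts | hts | hts
    · have := main (s - t) _ ⟨by linarith, t, ht, by simpa using hs, rfl⟩
      rw [abs_sub_comm, abs_sub_comm t s, abs_of_pos (by linarith : 0 < s - t)]
      simpa using this
    · subst hts
      simp only [sub_self, abs_zero]
      have := Real.rpow_nonneg (le_refl (0 : ℝ)) (δ / 2)
      positivity
    · have := main (t - s) _ ⟨by linarith, s, hs, by simpa using ht, rfl⟩
      rw [abs_of_pos (by linarith : 0 < t - s)]
      simpa using this
  · rintro r v ⟨hr, p, hp, hq, rfl⟩ hrR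
    by_cases hcase : p + 2 * r < 0
    · exact ⟨_, ⟨by linarith, p, hp, ⟨by linarith [hp.1], hcase⟩, rfl⟩, 
        (hstep p r hr hp ⟨by linarith [hp.1], hcase⟩).1⟩
    · have hp' : p - r ∈ Ioo (-(R ^ 2)) 0 := ⟨by linarith, by linarith [hp.2]⟩
      have e1 : p - r + 2 * r = p + r := by ring
      have e2 : p - r + r = p := by ring
      have := (hstep (p - r) r hr hp' (by rwa [e1])).2
      rw [e2] at this
      refine ⟨_, ⟨by linarith, p - r, hp', by rwa [e1], rfl⟩, ?_⟩
      rw [e1] at *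
      exact this
  · rintro r v ⟨hr, p, hp, hq, rfl⟩ hrR
    have b1 := hsup _ hp
    have b2 := hsup _ hq
    have b3 : R ^ δ ≤ 3 * r ^ (δ / 2) := by
      calc R ^ δ = (R ^ 2) ^ (δ / 2) := by 
            rw [← sqrt_rpow_aux _ _ (by positivity), Real.sqrt_sq hR.le]
        _ ≤ (3 * r) ^ (δ / 2) := Real.rpow_le_rpow (by positivity) (by linarith) (by linarith [hδ.1])
        _ ≤ 3 * r ^ (δ / 2) := rpow_mul_le _ _ _ (by norm_num) hr.le (by linarith [hδ.2])
    calc _ ≤ 800 * (K * R ^ δ) := by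
          rw [abs_le] at *
          constructor <;> linarith [b1.1, b1.2, b2.1, b2.2]
      _ ≤ 800 * (K * (3 * r ^ (δ / 2))) := by gcongr
      _ = 2400 * (K * r ^ (δ / 2)) := by ring
      _ ≤ 2400 / c * (K * r ^ (δ / 2)) := by gcongr
      _ = _ := by ring

lemma part_b_space (hδ : δ ∈ Ioo (0 : ℝ) 1) (hu : ContDiffOn ℝ (⊤ : ℕ∞)
      (fun z : ℝ × EuclideanSpace ℝ (Fin d) => u z.1 z.2) (parQ d R)) (hR : 0 < R)
    (K₁ K₂ M A : ℝ) (hK₁ : 0 ≤ K₁) (hK₂ : 0 ≤ K₂) (hM : 0 ≤ M) (hA0 : 0 ≤ A)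
    (h1 : ∀ x : EuclideanSpace ℝ (Fin d), ‖x‖ < 3 / 4 * R → ∀ t ∈ Ioo (-(R ^ 2)) 0, 
      ∀ s ∈ Ioo (-(R ^ 2)) 0, ∀ i j, |sd2 i j (u t) x - sd2 i j (u s) x| ≤ 
        (A * (K₁ + K₂ + R ^ (-(2 + δ)) * M)) * |t - s| ^ (δ / 2))
    (h2 : HolderTPar d (δ / 2) (parQ d R) (td u) K₂)
    (h3 : ∀ z ∈ parQ d R, |u z.1 z.2| ≤ M) :
    HolderXPar d δ (parQ d (R/2)) (td u)
            ((66 + d ^ 2 * A) / (1 - 2 ^ (δ - 1)) * (K₁ + K₂ + R ^ (-(2 + δ)) * M)) := by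
  obtain ⟨hc0, hc1⟩ := c_aux δ hδ.2
  set c : ℝ := 1 - 2 ^ (δ - 1) with hc
  set K := K₁ + K₂ + R ^ (-(2 + δ)) * M with hK
  have hM' : 0 ≤ R ^ (-(2 + δ)) * M := mul_nonneg (Real.rpow_nonneg hR.le _) hM
  have hK0 : 0 ≤ K := by positivity
  have hA : 0 ≤ (66 + d ^ 2 * A) / c * K := by positivity
  have hK2K : K₂ ≤ K := by linarith
  have h66 : 66 ≤ (66 + d ^ 2 * A) / c := by 
    rw [le_div_iff₀ hc0]
    have : 0 ≤ d ^ 2 * A := by positivity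
    nlinarith
  intro t x y hx hy
  obtain ⟨ht, hx⟩ := hx
  obtain ⟨-, hy⟩ := hy
  simp only at ht hx hy
  have hx' := mem_ball_zero_iff.mp hx
  have hRR : (R / 2) ^ 2 = R ^ 2 / 4 := by ring
  rw [hRR] at ht
  have hR2 : 0 < R ^ 2 := by positivity
  have ht' : t ∈ Ioo (-(R ^ 2)) 0 := ⟨by linarith [ht.1], ht.2⟩
  have hquot : ∀ τ, 0 < τ → τ ≤ R ^ 2 / 2 → ∀ z ∈ ball (0 : EuclideanSpace ℝ (Fin d)) R, 
      |td u t z - (u t z - u (t - τ) z) / τ| ≤ K₂ * τ ^ (δ / 2) := by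
    intro τ hτ hτR z hz
    exact time_quot (fun τ => u τ z) (-(R ^ 2)) 0 (δ / 2) K₂ t τ (by linarith [hδ.1]) hK₂ hτ 
        (slice_t hu hz) (fun t ht s hs => h2 t s z ⟨ht, hz⟩ ⟨hs, hz⟩) ht' 
        ⟨by linarith [ht.1], by linarith [ht.2]⟩
  have hsup : ∀ z ∈ ball (0 : EuclideanSpace ℝ (Fin d)) R, |td u t z| ≤ 4 * (K * R ^ δ) := by
    intro z hz
    have k1 := hquot (R ^ 2 / 2) (by positivity) le_rfl z hz
    have b1 := h3 (t, z) ⟨ht', hz⟩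
    have b2 := h3 (t - R ^ 2 / 2, z) ⟨⟨by simp only; linarith [ht.1], by simp only; linarith [ht.2]⟩, hz⟩
    simp only at b1 b2
    have b3 : |(u t z - u (t - R ^ 2 / 2) z) / (R ^ 2 / 2)| ≤ 4 * (R ^ δ * (R ^ (-(2 + δ)) * M)) := by
      rw [abs_div, abs_of_pos (by positivity : 0 < R ^ 2 / 2), div_le_iff₀ (by positivity)]
      have := R_aux (δ := δ) hR M
      have : |u t z - u (t - R ^ 2 / 2) z| ≤ 2 * M := by
        rw [abs_le] at *; constructor <;> linarith [b1.1, b1.2, b2.1, b2.2]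
      linarith
    have b4 : (R ^ 2 / 2) ^ (δ / 2) ≤ R ^ δ := by
      calc _ ≤ (R ^ 2) ^ (δ / 2) := 
            Real.rpow_le_rpow (by positivity) (by linarith) (by linarith [hδ.1])
        _ = R ^ δ := by rw [← sqrt_rpow_aux _ _ (by positivity), Real.sqrt_sq hR.le]
    have b5 : K₂ * (R ^ 2 / 2) ^ (δ / 2) ≤ K₂ * R ^ δ := by gcongr
    have b6 : 4 * (K * R ^ δ) = 4 * (R ^ δ * (R ^ (-(2 + δ)) * M)) + 4 * (K₂ * R ^ δ) 
      + 4 * (K₁ * R ^ δ) := by rw [hK]; ring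
    have b7 : 0 ≤ K₁ * R ^ δ := by positivity
    have b8 : 0 ≤ K₂ * R ^ δ := by positivity
    rw [abs_le] at *
    constructor <;> linarith [b3.1, b3.2, k1.1, k1.2]
  have hbase : ∀ y ∈ ball (0 : EuclideanSpace ℝ (Fin d)) R, R / 8 ≤ dist x y → 
      |td u t y - td u t x| ≤ (66 + d ^ 2 * A) / c * K * dist x y ^ δ := by
    intro y hy hr
    have b1 := hsup _ hy
    have b2 := hsup x (mem_ball_zero_iff.mpr (by linarith))
    have b3 : R ^ δ ≤ 8 * dist x y ^ δ := 
      (Real.rpow_le_rpow hR.le (by linarith) hδ.1.le).trans 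
        (rpow_mul_le 8 (dist x y) δ (by norm_num) dist_nonneg hδ.2.le)
    calc _ ≤ 8 * (K * R ^ δ) := by
          rw [abs_le] at *
          constructor <;> linarith [b1.1, b1.2, b2.1, b2.2]
      _ ≤ 8 * (K * (8 * dist x y ^ δ)) := by gcongr
      _ = 64 * (K * dist x y ^ δ) := by ring
      _ ≤ (66 + d ^ 2 * A) / c * (K * dist x y ^ δ) := by gcongr; linarith
      _ = _ := by ring
  have main := dyadic_aux (fun r v => 0 < r ∧ r < R / 4 ∧ ∃ e : EuclideanSpace ℝ (Fin d), ‖e‖ = r ∧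
      v = td u t (x + e) - td u t x) (R / 8) ((66 + d ^ 2 * A) / c * K) 
      ((66 + d ^ 2 * A) * K) δ c hc hA 
      (by rw [div_mul_eq_mul_div, div_mul_cancel₀ _ hc0.ne']) (fun r v h => h.1) ?_ ?_
  · rw [abs_sub_comm]
    rcases le_or_gt (R / 8) (dist x y) with hr | hr
    · exact hbase y (ball_subset_ball (by linarith) hy) hr
    rcases eq_or_ne x y with rfl | hxy
    · simp only [sub_self, abs_zero, dist_self]
      have := Real.rpow_nonneg (le_refl (0 : ℝ)) δ
      positivity
    · have := main (dist x y) _ ⟨dist_pos.mpr hxy, by linarith, y - x, 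
        by rw [dist_comm, dist_eq_norm], rfl⟩
      simpa using this
  · rintro r v ⟨hr, hr4, e, he, rfl⟩ hr8
    have hze : ‖(2 : ℝ) • e‖ = 2 * r := by rw [norm_smul, he]; simp
    refine ⟨td u t (x + (2 : ℝ) • e) - td u t x, ⟨by linarith, by linarith, _, hze, rfl⟩, ?_⟩
    have hτR : r ^ 2 ≤ R ^ 2 / 2 := by nlinarith
    have hτ : 0 < r ^ 2 := by positivity
    have hs' : t - r ^ 2 ∈ Ioo (-(R ^ 2)) 0 := ⟨by linarith [ht.1], by linarith [ht.2]⟩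
    have er : (r ^ 2) ^ (δ / 2) = r ^ δ := by
      rw [← sqrt_rpow_aux _ _ hτ.le, Real.sqrt_sq hr.le]
    have q0 := hquot (r ^ 2) hτ hτR x (mem_ball_zero_iff.mpr (by linarith))
    have q1 := hquot (r ^ 2) hτ hτR (x + e) (mem_ball_of _ _ (by linarith))
    have q2 := hquot (r ^ 2) hτ hτR (x + (2 : ℝ) • e) (mem_ball_of _ _ (by linarith))
    have q3 := line_diff (slice_x hu ht') (slice_x hu hs') x e (3 / 4 * R) (A * K * r ^ δ) 
      (by linarith) (fun y hy i j => by
        have := h1 y (mem_ball_zero_iff.mp hy) t ht' _ hs' i j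
        rwa [sub_sub_cancel, abs_of_pos hτ, er] at this) 
      (mem_ball_zero_iff.mpr (by linarith)) (mem_ball_of _ _ (by linarith))
    rw [er] at q0 q1 q2
    rw [he] at q3
    generalize u t x - u (t - r ^ 2) x = g0 at *
    generalize u t (x + e) - u (t - r ^ 2) (x + e) = g1 at *
    generalize u t (x + (2 : ℝ) • e) - u (t - r ^ 2) (x + (2 : ℝ) • e) = g2 at *
    have q4 : |g2 / r ^ 2 - g1 / r ^ 2 - (g1 / r ^ 2 - g0 / r ^ 2)| ≤ d ^ 2 * A * K * r ^ δ := by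
      rw [← sub_div, ← sub_div, ← sub_div, abs_div, abs_of_pos hτ, div_le_iff₀ hτ]
      linarith
    have q5 : K₂ * r ^ δ ≤ K * r ^ δ := by gcongr
    have q6 : 0 ≤ d ^ 2 * A * K * r ^ δ := by positivity
    have q7 : 0 ≤ K * r ^ δ := by positivity
    have h7 := le_abs_self (td u t (x + (2 : ℝ) • e) - td u t x)
    have h8 := neg_abs_le (td u t (x + (2 : ℝ) • e) - td u t x)
    generalize |td u t (x + (2 : ℝ) • e) - td u t x| = W at *
    rw [abs_le] at *
    constructor <;> linarith [q0.1, q0.2, q1.1, q1.2, q2.1, q2.2, q4.1, q4.2]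
  · rintro r v ⟨hr, hr4, e, he, rfl⟩ hr8
    have := hbase (x + e) (mem_ball_of _ _ (by linarith)) (by rw [dist_self_add_right]; linarith)
    rwa [dist_self_add_right, he] at this

end main

lemma holderT_mono {d : ℕ} {γ : ℝ} {Q Q' : Set (ℝ × EuclideanSpace ℝ (Fin d))}
    {g : ℝ → EuclideanSpace ℝ (Fin d) → ℝ} {K K' : ℝ} (h : HolderTPar d γ Q g K) 
    (hQ : Q' ⊆ Q) (hK : K ≤ K') : HolderTPar d γ Q' g K' := by
  intro t s x h1 h2
  refine (h t s x (hQ h1) (hQ h2)).trans ?_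
  have := Real.rpow_nonneg (abs_nonneg (t - s)) γ
  gcongr

lemma holderX_mono {d : ℕ} {γ : ℝ} {Q Q' : Set (ℝ × EuclideanSpace ℝ (Fin d))}
    {g : ℝ → EuclideanSpace ℝ (Fin d) → ℝ} {K K' : ℝ} (h : HolderXPar d γ Q g K) 
    (hQ : Q' ⊆ Q) (hK : K ≤ K') : HolderXPar d γ Q' g K' := by
  intro t s x h1 h2
  refine (h t s x (hQ h1) (hQ h2)).trans ?_
  have : 0 ≤ dist s x ^ γ := Real.rpow_nonneg dist_nonneg γ
  gcongr

/-- **Lemma 6.1**: interpolation inequalities for parabolic partial Hölder seminorms. -/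
theorem parabolic_holder_interpolation
    (d : ℕ) (δ : ℝ) (hd : 1 ≤ d) (hδ : δ ∈ Ioo (0 : ℝ) 1) :
    ∃ N : ℝ, 0 < N ∧
      ∀ (R : ℝ) (u : ℝ → EuclideanSpace ℝ (Fin d) → ℝ), 0 < R →
        ContDiffOn ℝ (⊤ : ℕ∞)
          (fun z : ℝ × EuclideanSpace ℝ (Fin d) => u z.1 z.2) (parQ d R) →
        -- part (a)
        ((∀ K₁ K₂ : ℝ, 0 ≤ K₁ → 0 ≤ K₂ →
          (∀ i : Fin d, HolderXPar d δ (parQ d R) (fun t x => sd i (u t) x) K₁) →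
          HolderTPar d ((1 + δ) / 2) (parQ d R) u K₂ →
          HolderTPar d ((1 + δ) / 2) (parQ d (R/2)) u (N * (K₁ + K₂)) ∧
          ∀ i : Fin d,
            HolderTPar d (δ/2) (parQ d (R/2)) (fun t x => sd i (u t) x)
              (N * (K₁ + K₂)) ∧
            HolderXPar d δ (parQ d (R/2)) (fun t x => sd i (u t) x)
              (N * (K₁ + K₂))) ∧
        -- part (b)
        (∀ K₁ K₂ M : ℝ, 0 ≤ K₁ → 0 ≤ K₂ → 0 ≤ M →
          (∀ i j : Fin d, HolderXPar d δ (parQ d R) (fun t x => sd2 i j (u t) x) K₁) →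
          HolderTPar d (δ/2) (parQ d R) (td u) K₂ →
          (∀ z ∈ parQ d R, |u z.1 z.2| ≤ M) →
          (HolderTPar d (δ/2) (parQ d (R/2)) (td u)
            (N * (K₁ + K₂ + R ^ (-(2 + δ)) * M)) ∧
           HolderXPar d δ (parQ d (R/2)) (td u)
            (N * (K₁ + K₂ + R ^ (-(2 + δ)) * M))) ∧
          ∀ i j : Fin d,
            HolderTPar d (δ/2) (parQ d (R/2)) (fun t x => sd2 i j (u t) x)
              (N * (K₁ + K₂ + R ^ (-(2 + δ)) * M)) ∧
            HolderXPar d δ (parQ d (R/2)) (fun t x => sd2 i j (u t) x)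
              (N * (K₁ + K₂ + R ^ (-(2 + δ)) * M)))) := by
  obtain ⟨hc0, hc1⟩ := c_aux δ hδ.2
  obtain ⟨hc2, hc3⟩ := c_aux (δ / 2) (by linarith [hδ.2])
  obtain ⟨A, hA⟩ : ∃ A : ℝ, A = 2400 / (1 - 2 ^ (δ / 2 - 1)) := ⟨_, rfl⟩
  have hA0 : 0 ≤ A := by rw [hA]; positivity
  obtain ⟨A', hA'⟩ : ∃ A' : ℝ, A' = (66 + d ^ 2 * A) / (1 - 2 ^ (δ - 1)) := ⟨_, rfl⟩
  have hA'0 : 0 ≤ A' := by rw [hA']; positivity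
  refine ⟨2 + A + A', by positivity, ?_⟩
  intro R u hR hu
  have hRR : (R / 2) ^ 2 ≤ R ^ 2 := by nlinarith
  have hQ : parQ d (R / 2) ⊆ parQ d R :=
    prod_mono (Ioo_subset_Ioo (by linarith) le_rfl) (ball_subset_ball (by linarith))
  refine ⟨?_, ?_⟩
  · intro K₁ K₂ hK₁ hK₂ h1 h2
    have e0 : 2 * (K₁ + K₂) ≤ (2 + A + A') * (K₁ + K₂) := by gcongr; linarith
    refine ⟨holderT_mono h2 hQ (by linarith), fun i => ⟨?_, holderX_mono (h1 i) hQ (by linarith)⟩⟩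
    exact holderT_mono (part_a_time hδ hu hR K₁ K₂ hK₁ hK₂ i (h1 i) h2) subset_rfl e0
  · intro K₁ K₂ M hK₁ hK₂ hM h1 h2 h3
    have hM' : 0 ≤ R ^ (-(2 + δ)) * M := mul_nonneg (Real.rpow_nonneg hR.le _) hM
    have hK0 : 0 ≤ K₁ + K₂ + R ^ (-(2 + δ)) * M := by positivity
    have e0 : 2 * (K₁ + K₂ + R ^ (-(2 + δ)) * M) ≤ 
      (2 + A + A') * (K₁ + K₂ + R ^ (-(2 + δ)) * M) := by gcongr; linarith
    have e1 : A * (K₁ + K₂ + R ^ (-(2 + δ)) * M) ≤ 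
      (2 + A + A') * (K₁ + K₂ + R ^ (-(2 + δ)) * M) := by gcongr; linarith
    have e2 : A' * (K₁ + K₂ + R ^ (-(2 + δ)) * M) ≤ 
      (2 + A + A') * (K₁ + K₂ + R ^ (-(2 + δ)) * M) := by gcongr; linarith
    have hT : ∀ x : EuclideanSpace ℝ (Fin d), ‖x‖ < 3 / 4 * R → ∀ t ∈ Ioo (-(R ^ 2)) 0, 
      ∀ s ∈ Ioo (-(R ^ 2)) 0, ∀ i j, |sd2 i j (u t) x - sd2 i j (u s) x| ≤ 
        (A * (K₁ + K₂ + R ^ (-(2 + δ)) * M)) * |t - s| ^ (δ / 2) := by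
      intro x hx t ht s hs i j
      rw [hA]
      exact part_b_time hδ hu hR K₁ K₂ M hK₁ hK₂ hM i j (h1 i j) h2 h3 x hx t s ht hs
    have hX := part_b_space hδ hu hR K₁ K₂ M A hK₁ hK₂ hM hA0 hT h2 h3
    rw [← hA'] at hX
    refine ⟨⟨holderT_mono h2 hQ (by linarith), holderX_mono hX subset_rfl e2⟩, fun i j => 
      ⟨?_, holderX_mono (h1 i j) hQ (by linarith)⟩⟩
    refine holderT_mono (K := A * (K₁ + K₂ + R ^ (-(2 + δ)) * M)) ?_ subset_rfl e1
    intro t s x ht hs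
    have hx := mem_ball_zero_iff.mp ht.2
    simp only at hx
    exact hT x (by linarith) t (hQ ht).1 s (hQ hs).1 i j
end
end

section
/- W²_ε estimate of F. Lin (Lemma 3.1): There exist constants ε ∈ (0,1] and N, depending only on d and ν, such that the following holds. Let a = [a^{ij}] be symmetric, measurable, uniformly elliptic coefficients with constant ν on ℝ^d, let r > 0, and let w be continuous on the closed ball of radius r, twice continuously differentiable in B_r with Hessian D²w Lebesgue integrable over B_r, and w = 0 on ∂B_r. Then (1/|B_r|) ∫_{B_r} |D²w|^ε dx ≤ N ( (1/|B_r|) ∫_{B_r} |a^{ij}D_{ij}w|^d dx )^{ε/d}. -/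
open MeasureTheory Metric Set Filter

noncomputable section

/-- First-order partial derivative `D_i`. -/
def pd {d : ℕ} (i : Fin d) (v : EuclideanSpace ℝ (Fin d) → ℝ)
    (x : EuclideanSpace ℝ (Fin d)) : ℝ :=
  fderiv ℝ v x (EuclideanSpace.single i 1)

/-- Second-order partial derivative `D_i D_j`. -/
def pd2 {d : ℕ} (i j : Fin d) (v : EuclideanSpace ℝ (Fin d) → ℝ)
    (x : EuclideanSpace ℝ (Fin d)) : ℝ :=
  pd i (fun y => pd j v y) x

/-- Partial Hölder bound with respect to the first `q` coordinates:
`|g x - g y| ≤ K |x' - y'|^δ` whenever `x'' = y''` (note `dist x y = |x' - y'|` then). -/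
def PHolderX (d q : ℕ) (δ : ℝ) (Ω : Set (EuclideanSpace ℝ (Fin d)))
    (g : EuclideanSpace ℝ (Fin d) → ℝ) (K : ℝ) : Prop :=
  ∀ x ∈ Ω, ∀ y ∈ Ω, (∀ i : Fin d, q ≤ (i : ℕ) → x i = y i) →
    |g x - g y| ≤ K * dist x y ^ δ

/-- Full Hölder bound. -/
def HolderB {d : ℕ} (δ : ℝ) (Ω : Set (EuclideanSpace ℝ (Fin d)))
    (g : EuclideanSpace ℝ (Fin d) → ℝ) (K : ℝ) : Prop :=
  ∀ x ∈ Ω, ∀ y ∈ Ω, |g x - g y| ≤ K * dist x y ^ δ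

/-- Uniform ellipticity with constant `ν` (two-sided bound). -/
def UnifElliptic (d : ℕ) (ν : ℝ)
    (a : Fin d → Fin d → EuclideanSpace ℝ (Fin d) → ℝ) : Prop :=
  ∀ (x : EuclideanSpace ℝ (Fin d)) (ξ : Fin d → ℝ),
    ν * ∑ i, ξ i ^ 2 ≤ ∑ i, ∑ j, a i j x * ξ i * ξ j ∧
      ∑ i, ∑ j, a i j x * ξ i * ξ j ≤ ν⁻¹ * ∑ i, ξ i ^ 2

/-- Hilbert–Schmidt norm of the Hessian. -/
def hessNorm {d : ℕ} (v : EuclideanSpace ℝ (Fin d) → ℝ)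
    (x : EuclideanSpace ℝ (Fin d)) : ℝ :=
  Real.sqrt (∑ i, ∑ j, pd2 i j v x ^ 2)

/-- Euclidean norm of the gradient. -/
def gradNorm {d : ℕ} (v : EuclideanSpace ℝ (Fin d) → ℝ)
    (x : EuclideanSpace ℝ (Fin d)) : ℝ :=
  Real.sqrt (∑ i, pd i v x ^ 2)


section LinHelpers

open scoped Topology

abbrev Eu (d : ℕ) := EuclideanSpace ℝ (Fin d)

lemma eu_decomp {d : ℕ} (h : Eu d) : h = ∑ i, h i • (EuclideanSpace.single i (1:ℝ) : Eu d) := by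
  ext k
  simp [Finset.sum_apply, Pi.single_apply]

lemma clm_eq_sum {d : ℕ} (L : Eu d →L[ℝ] ℝ) (h : Eu d) :
    L h = ∑ i, h i * L (EuclideanSpace.single i 1) := by
  conv_lhs => rw [eu_decomp h]
  simp

lemma pd_contDiffAt {d : ℕ} {v : Eu d → ℝ} {x : Eu d} (hv : ContDiffAt ℝ 2 v x) (j : Fin d) :
    ContDiffAt ℝ 1 (fun y => pd j v y) x := by
  unfold pd
  exact (hv.fderiv_right (m := 1) (by norm_num)).clm_apply contDiffAt_const

lemma fderiv_eq_sum_pd {d : ℕ} (v : Eu d → ℝ) (x h : Eu d) :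
    fderiv ℝ v x h = ∑ i, h i * pd i v x := clm_eq_sum _ _

lemma pd2_symm {d : ℕ} {v : Eu d → ℝ} {x : Eu d} (hv : ContDiffAt ℝ 2 v x) (i j : Fin d) :
    pd2 i j v x = pd2 j i v x := by
  have hd : DifferentiableAt ℝ (fderiv ℝ v) x :=
    (hv.fderiv_right (m := 1) (by norm_num)).differentiableAt (by norm_num)
  have key : ∀ i j, pd2 i j v x = fderiv ℝ (fderiv ℝ v) x (EuclideanSpace.single i 1)
      (EuclideanSpace.single j 1) := by
    intro i j
    unfold pd2 pd
    rw [fderiv_clm_apply hd (by fun_prop)]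
    simp
  rw [key, key]
  exact (hv.isSymmSndFDerivAt (by simp)) _ _

lemma pd2_eq_snd {d : ℕ} {v : Eu d → ℝ} {x : Eu d} (hv : ContDiffAt ℝ 2 v x) (h : Eu d) :
    HasDerivAt (fun t : ℝ => fderiv ℝ v (x + t • h) h)
      (∑ i, ∑ j, pd2 i j v x * h i * h j) 0 := by
  have hl : HasDerivAt (fun t : ℝ => x + t • h) h 0 := by
    simpa using ((hasDerivAt_id (0:ℝ)).smul_const h).const_add x
  simp_rw [fderiv_eq_sum_pd v]
  rw [Finset.sum_comm]
  apply HasDerivAt.fun_sum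
  intro j _
  have h1 : HasFDerivAt (fun y => pd j v y) (fderiv ℝ (fun y => pd j v y) x) x :=
    ((pd_contDiffAt hv j).differentiableAt (by norm_num)).hasFDerivAt
  have h2 : HasDerivAt (fun t : ℝ => pd j v (x + t • h)) (fderiv ℝ (fun y => pd j v y) x h) 0 := by
    exact h1.comp_hasDerivAt_of_eq 0 hl (by simp)
  have h3 := h2.const_mul (h j)
  rw [fderiv_eq_sum_pd] at h3
  have h4 : ∑ i, pd2 i j v x * h i * h j = h j * ∑ i, h i * pd i (fun y => pd j v y) x := by
    rw [Finset.mul_sum]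
    refine Finset.sum_congr rfl fun i _ => ?_
    unfold pd2
    ring
  rw [h4]
  exact h3

lemma localMin_second {d : ℕ} {v : Eu d → ℝ} {x : Eu d} (hv : ContDiffAt ℝ 2 v x)
    (hm : IsLocalMin v x) :
    (∀ i, pd i v x = 0) ∧ ∀ h : Eu d, 0 ≤ ∑ i, ∑ j, pd2 i j v x * h i * h j := by
  have hf0 : fderiv ℝ v x = 0 := hm.fderiv_eq_zero
  refine ⟨fun i => by simp [pd, hf0], fun h => ?_⟩
  by_contra! hneg
  have hcl : Continuous (fun t : ℝ => x + t • h) := by fun_prop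
  have htend : Tendsto (fun t : ℝ => x + t • h) (𝓝 0) (𝓝 x) := by
    have := hcl.tendsto 0
    simpa using this
  have hev : ∀ᶠ y in 𝓝 x, DifferentiableAt ℝ v y := by
    have := hv.eventually (by simp)
    exact this.mono fun y hy => hy.differentiableAt (by norm_num)
  have hgd : deriv (fun t : ℝ => v (x + t • h)) =ᶠ[𝓝 0] fun t => fderiv ℝ v (x + t • h) h := by
    filter_upwards [htend.eventually hev] with t ht
    have hl : HasDerivAt (fun t : ℝ => x + t • h) h t := by
      simpa using ((hasDerivAt_id t).smul_const h).const_add x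
    exact (ht.hasFDerivAt.comp_hasDerivAt t hl).deriv
  have h2 : deriv (deriv (fun t : ℝ => v (x + t • h))) 0 = ∑ i, ∑ j, pd2 i j v x * h i * h j := by
    rw [hgd.deriv_eq]
    exact (pd2_eq_snd hv h).deriv
  have h1 : deriv (fun t : ℝ => v (x + t • h)) 0 = 0 := by
    rw [hgd.eq_of_nhds]; simp [hf0]
  have hc : ContinuousAt (fun t : ℝ => v (x + t • h)) 0 := by
    have : ContinuousAt v (x + (0:ℝ) • h) := by simpa using hv.continuousAt
    exact ContinuousAt.comp (f := fun t : ℝ => x + t • h) this hcl.continuousAt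
  have hmax := isLocalMax_of_deriv_deriv_neg (by rw [h2]; exact hneg) h1 hc
  have hmin : ∀ᶠ t in 𝓝 (0:ℝ), v x ≤ v (x + t • h) := htend.eventually hm
  have hconst : (fun t : ℝ => v (x + t • h)) =ᶠ[𝓝 0] fun _ => v x := by
    filter_upwards [hmax, hmin] with t h1 h2
    simp only [zero_smul, add_zero] at h1
    exact le_antisymm h1 h2
  have : deriv (deriv (fun t : ℝ => v (x + t • h))) 0 = 0 := by
    have h5 : deriv (fun t : ℝ => v (x + t • h)) =ᶠ[𝓝 0] fun _ => 0 := by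
      have := hconst.deriv
      simpa using this
    rw [h5.deriv_eq]; simp
  rw [h2] at this
  linarith


lemma pd2_add {d : ℕ} {u v : Eu d → ℝ} {x : Eu d} (hu : ContDiffAt ℝ 2 u x)
    (hv : ContDiffAt ℝ 2 v x) (i j : Fin d) :
    pd2 i j (fun y => u y + v y) x = pd2 i j u x + pd2 i j v x := by
  have e1 : (fun y => pd j (fun y => u y + v y) y) =ᶠ[𝓝 x] fun y => pd j u y + pd j v y := by
    filter_upwards [hu.eventually (by simp), hv.eventually (by simp)] with y h1 h2
    unfold pd
    rw [fderiv_fun_add (h1.differentiableAt (by norm_num)) (h2.differentiableAt (by norm_num))]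
    rfl
  unfold pd2
  rw [pd, e1.fderiv_eq, fderiv_fun_add ((pd_contDiffAt hu j).differentiableAt (by norm_num))
    ((pd_contDiffAt hv j).differentiableAt (by norm_num))]
  rfl

lemma pd2_const_mul {d : ℕ} {u : Eu d → ℝ} {x : Eu d} (c : ℝ) (hu : ContDiffAt ℝ 2 u x)
    (i j : Fin d) :
    pd2 i j (fun y => c * u y) x = c * pd2 i j u x := by
  have e1 : (fun y => pd j (fun y => c * u y) y) =ᶠ[𝓝 x] fun y => c * pd j u y := by
    filter_upwards [hu.eventually (by simp)] with y h1
    unfold pd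
    rw [fderiv_const_mul (h1.differentiableAt (by norm_num))]
    rfl
  unfold pd2
  rw [pd, e1.fderiv_eq, fderiv_const_mul ((pd_contDiffAt hu j).differentiableAt (by norm_num))]
  rfl

lemma pd_sub_inner {d : ℕ} {u : Eu d → ℝ} {x : Eu d} (p : Eu d) (hu : DifferentiableAt ℝ u x)
    (i : Fin d) : pd i (fun z => u z - inner ℝ p z) x = pd i u x - p i := by
  unfold pd
  have h : HasFDerivAt (fun z : Eu d => (inner ℝ p z : ℝ)) (innerSL ℝ p) x :=
    (innerSL ℝ p).hasFDerivAt
  rw [(hu.hasFDerivAt.fun_sub h).fderiv]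
  simp [EuclideanSpace.inner_single_right]

lemma pd2_sub_inner {d : ℕ} {u : Eu d → ℝ} {x : Eu d} (p : Eu d) (hu : ContDiffAt ℝ 2 u x)
    (i j : Fin d) : pd2 i j (fun z => u z - inner ℝ p z) x = pd2 i j u x := by
  have e1 : (fun y => pd j (fun z => u z - inner ℝ p z) y) =ᶠ[𝓝 x] fun y => pd j u y - p j := by
    filter_upwards [hu.eventually (by simp)] with y h1
    exact pd_sub_inner p (h1.differentiableAt (by norm_num)) j
  unfold pd2
  rw [pd, e1.fderiv_eq, fderiv_sub_const]
  rfl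

lemma hasFDerivAt_nsq {d : ℕ} (y x : Eu d) :
    HasFDerivAt (fun z : Eu d => ‖z - y‖ ^ 2) (2 • innerSL ℝ (x - y)) x := by
  have h := ((hasFDerivAt_id x).sub_const y).norm_sq
  exact h

lemma pd_nsq {d : ℕ} (y x : Eu d) (i : Fin d) :
    pd i (fun z : Eu d => ‖z - y‖ ^ 2) x = 2 * (x i - y i) := by
  unfold pd
  rw [(hasFDerivAt_nsq y x).fderiv]
  simp [EuclideanSpace.inner_single_right]

lemma hasFDerivAt_coord {d : ℕ} (y x : Eu d) (j : Fin d) :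
    HasFDerivAt (fun z : Eu d => (z j - y j)) (EuclideanSpace.proj j : Eu d →L[ℝ] ℝ) x := by
  exact ((EuclideanSpace.proj j : Eu d →L[ℝ] ℝ).hasFDerivAt).sub_const _

lemma pd2_nsq {d : ℕ} (y x : Eu d) (i j : Fin d) :
    pd2 i j (fun z : Eu d => ‖z - y‖ ^ 2) x = if i = j then 2 else 0 := by
  unfold pd2
  simp_rw [pd_nsq]
  unfold pd
  rw [((hasFDerivAt_coord y x j).const_mul 2).fderiv]
  simp [Pi.single_apply, eq_comm]

lemma pd_gexp {d : ℕ} (b : ℝ) (y x : Eu d) (i : Fin d) :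
    pd i (fun z : Eu d => Real.exp (-b * ‖z - y‖ ^ 2)) x =
      -2 * b * ((x i - y i) * Real.exp (-b * ‖x - y‖ ^ 2)) := by
  unfold pd
  rw [((hasFDerivAt_nsq y x).const_mul (-b)).exp.fderiv]
  simp [EuclideanSpace.inner_single_right]
  ring

lemma pd2_gexp {d : ℕ} (b : ℝ) (y x : Eu d) (i j : Fin d) :
    pd2 i j (fun z : Eu d => Real.exp (-b * ‖z - y‖ ^ 2)) x =
      ((if i = j then -2 * b else 0) + 4 * b ^ 2 * ((x i - y i) * (x j - y j)))
        * Real.exp (-b * ‖x - y‖ ^ 2) := by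
  unfold pd2
  simp_rw [pd_gexp]
  unfold pd
  rw [(((hasFDerivAt_coord y x j).fun_mul
    ((hasFDerivAt_nsq y x).const_mul (-b)).exp).const_mul (-2 * b)).fderiv]
  by_cases h : i = j
  · subst h
    simp [EuclideanSpace.inner_single_right]
    ring
  · simp [EuclideanSpace.inner_single_right, h, Pi.single_apply, Ne.symm h]
    ring

open scoped MatrixOrder in
lemma psd_factor {d : ℕ} {H : Matrix (Fin d) (Fin d) ℝ} (hA : H.PosSemidef) :
    ∃ B : Matrix (Fin d) (Fin d) ℝ, H = B.conjTranspose * B := by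
  obtain ⟨X, hX, -, hH⟩ :=
    CFC.exists_sqrt_of_isSelfAdjoint_of_quasispectrumRestricts hA.isHermitian
      (QuasispectrumRestricts.nnreal_of_nonneg hA.nonneg)
  refine ⟨X, ?_⟩
  have h2 : X.conjTranspose = X := hX.star_eq
  rw [h2]
  exact hH.symm

/-- linear algebra -/
lemma psd_facts {d : ℕ} (H : Matrix (Fin d) (Fin d) ℝ) (hs : ∀ i j, H i j = H j i)
    (hp : ∀ h : Eu d, 0 ≤ ∑ i, ∑ j, H i j * h i * h j) :
    (0 ≤ H.det ∧ H.det ≤ (∑ i, H i i) ^ d) ∧ (∀ i, 0 ≤ H i i) ∧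
    (∀ i j, |H i j| ≤ ∑ i, H i i) ∧
    ∀ (A : Fin d → Fin d → ℝ) (ν : ℝ),
      (∀ ξ : Fin d → ℝ, ν * ∑ i, ξ i ^ 2 ≤ ∑ i, ∑ j, A i j * ξ i * ξ j) →
      ν * ∑ i, H i i ≤ ∑ i, ∑ j, A i j * H i j := by
  have hpsd : H.PosSemidef := by
    refine Matrix.PosSemidef.of_dotProduct_mulVec_nonneg ?_ ?_
    · ext i j; simp [hs i j]
    · intro ξ
      have := hp (WithLp.toLp 2 ξ)
      simp only [dotProduct, Matrix.mulVec, star_trivial, Finset.mul_sum]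
      refine this.trans_eq ?_
      refine Finset.sum_congr rfl fun i _ => Finset.sum_congr rfl fun j _ => ?_
      ring
  obtain ⟨B, hB⟩ := psd_factor hpsd
  have hij : ∀ i j, H i j = ∑ k, B k i * B k j := by
    intro i j
    rw [hB]; simp [Matrix.mul_apply]
  have hdiag : ∀ i, 0 ≤ H i i := by
    intro i; rw [hij]; exact Finset.sum_nonneg fun k _ => mul_self_nonneg _
  have hle : ∀ i, H i i ≤ ∑ i, H i i := fun i =>
    Finset.single_le_sum (f := fun i => H i i) (fun k _ => hdiag k) (Finset.mem_univ i)
  refine ⟨⟨hpsd.det_nonneg, ?_⟩, hdiag, ?_, ?_⟩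
  · have h1 := hpsd.1.det_eq_prod_eigenvalues
    have h2 := hpsd.1.trace_eq_sum_eigenvalues
    have h3 : ∑ i, H i i = ∑ i, hpsd.1.eigenvalues i := by
      simpa [Matrix.trace] using h2
    rw [h1, h3]
    have h4 : ∀ i ∈ Finset.univ, hpsd.1.eigenvalues i ≤ ∑ i, hpsd.1.eigenvalues i := fun i hi =>
      Finset.single_le_sum (f := fun i => hpsd.1.eigenvalues i)
        (fun k _ => hpsd.eigenvalues_nonneg k) hi
    have := Finset.prod_le_prod (s := Finset.univ) (fun i _ => hpsd.eigenvalues_nonneg i) h4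
    simpa using this
  · intro i j
    have h1 := hle i
    have h2 := hle j
    have h3 : |H i j| ≤ (H i i + H j j) / 2 := by
      rw [hij i j, hij i i, hij j j, ← Finset.sum_add_distrib, Finset.sum_div]
      refine (Finset.abs_sum_le_sum_abs _ _).trans (Finset.sum_le_sum fun k _ => ?_)
      rw [abs_mul]
      nlinarith [sq_nonneg (|B k i| - |B k j|), sq_abs (B k i), sq_abs (B k j)]
    linarith
  · intro A ν hA
    have e1 : ∑ i, ∑ j, A i j * H i j = ∑ k, ∑ i, ∑ j, A i j * B k i * B k j := by
      simp_rw [hij, Finset.mul_sum]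
      rw [Finset.sum_comm' (t' := Finset.univ) (s' := fun _ => Finset.univ) (by simp)]
      conv_rhs => rw [Finset.sum_comm]; enter [2, i]; rw [Finset.sum_comm]
      rw [Finset.sum_comm]
      simp only [mul_assoc]
    have e2 : ν * ∑ i, H i i = ∑ k, ν * ∑ i, B k i ^ 2 := by
      rw [← Finset.mul_sum, Finset.sum_comm]
      simp_rw [hij, sq]
    rw [e1, e2]
    exact Finset.sum_le_sum fun k _ => hA _


def Lop {d : ℕ} (a : Fin d → Fin d → Eu d → ℝ) (v : Eu d → ℝ) (x : Eu d) : ℝ :=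
  ∑ i, ∑ j, a i j x * pd2 i j v x

lemma isOpen_not_forall {X : Type*} [TopologicalSpace X] {ι : Sort*} {U : Set X} (hU : IsOpen U)
    (g : ι → X → ℝ) (hg : ∀ i, ContinuousOn (g i) U) :
    IsOpen {x ∈ U | ¬ ∀ i, 0 ≤ g i x} := by
  have : {x ∈ U | ¬ ∀ i, 0 ≤ g i x} = ⋃ i, U ∩ (g i) ⁻¹' (Iio 0) := by
    ext x; simp
  rw [this]
  exact isOpen_iUnion fun i => (hg i).isOpen_inter_preimage hU isOpen_Iio

lemma measurable_forall {X : Type*} [TopologicalSpace X] [MeasurableSpace X]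
    [OpensMeasurableSpace X] {ι : Sort*} {U : Set X} (hU : IsOpen U)
    (g : ι → X → ℝ) (hg : ∀ i, ContinuousOn (g i) U) :
    MeasurableSet {x ∈ U | ∀ i, 0 ≤ g i x} := by
  have : {x ∈ U | ∀ i, 0 ≤ g i x} = U \ {x ∈ U | ¬ ∀ i, 0 ≤ g i x} := by
    ext x; simp only [mem_ofPred_eq, Set.mem_sdiff]; tauto
  rw [this]
  exact hU.measurableSet.diff (isOpen_not_forall hU g hg).measurableSet

lemma contDiffAt_of_ball {d : ℕ} {r : ℝ} {v : Eu d → ℝ} (hv : ContDiffOn ℝ 2 v (ball 0 r))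
    {x : Eu d} (hx : x ∈ ball (0 : Eu d) r) : ContDiffAt ℝ 2 v x :=
  hv.contDiffAt (isOpen_ball.mem_nhds hx)

lemma pd_continuousOn {d : ℕ} {r : ℝ} {v : Eu d → ℝ} (hv : ContDiffOn ℝ 2 v (ball 0 r))
    (i : Fin d) : ContinuousOn (fun x => pd i v x) (ball (0 : Eu d) r) := fun _ hx =>
  (pd_contDiffAt (contDiffAt_of_ball hv hx) i).continuousAt.continuousWithinAt

lemma pd2_continuousOn {d : ℕ} {r : ℝ} {v : Eu d → ℝ} (hv : ContDiffOn ℝ 2 v (ball 0 r))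
    (i j : Fin d) : ContinuousOn (fun x => pd2 i j v x) (ball (0 : Eu d) r) := by
  intro x hx
  have h := pd_contDiffAt (contDiffAt_of_ball hv hx) j
  have h2 : ContDiffAt ℝ 0 (fun y => pd2 i j v y) x := by
    unfold pd2
    unfold pd at h ⊢
    exact (h.fderiv_right (m := 0) (by norm_num)).clm_apply contDiffAt_const
  exact h2.continuousAt.continuousWithinAt

def gradJac {d : ℕ} (v : Eu d → ℝ) (x : Eu d) : Eu d →L[ℝ] Eu d :=
  LinearMap.toContinuousLinearMap (Matrix.toLin (EuclideanSpace.basisFun (Fin d) ℝ).toBasis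
    (EuclideanSpace.basisFun (Fin d) ℝ).toBasis (Matrix.of fun i j => pd2 i j v x).transpose)

lemma gradJac_det {d : ℕ} (v : Eu d → ℝ) (x : Eu d) :
    (gradJac v x).det = (Matrix.of fun i j => pd2 i j v x).det := by
  unfold gradJac
  rw [LinearMap.det_toContinuousLinearMap, LinearMap.det_toLin, Matrix.det_transpose]

lemma grad_hasFDerivAt {d : ℕ} {v : Eu d → ℝ} {x : Eu d} (hv : ContDiffAt ℝ 2 v x) (s : Set (Eu d)) :
    HasFDerivWithinAt (fun y => (WithLp.toLp 2 (fun i => pd i v y) : Eu d)) (gradJac v x) s x := by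
  rw [hasFDerivWithinAt_euclidean]
  intro i
  have h1 : HasFDerivAt (fun y => pd i v y) (fderiv ℝ (fun y => pd i v y) x) x :=
    ((pd_contDiffAt hv i).differentiableAt (by norm_num)).hasFDerivAt
  have h2 : fderiv ℝ (fun y => pd i v y) x =
      (PiLp.proj 2 (fun _ : Fin d => ℝ) i : Eu d →L[ℝ] ℝ) ∘L gradJac v x := by
    ext h
    rw [fderiv_eq_sum_pd]
    simp [gradJac, Matrix.toLin_apply, Matrix.mulVec, dotProduct, pd2, mul_comm,
      Finset.sum_apply, Pi.single_apply]
  rw [← h2]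
  exact h1.hasFDerivWithinAt

lemma area_est {d : ℕ} {ν : ℝ} {a : Fin d → Fin d → Eu d → ℝ} (hν : 0 < ν)
    (hell : UnifElliptic d ν a) {r : ℝ} {v : Eu d → ℝ} (hv : ContDiffOn ℝ 2 v (ball 0 r))
    {E : Set (Eu d)} (hE : MeasurableSet E) (hEs : E ⊆ ball 0 r) {p0 : Eu d} {δ : ℝ}
    (hp : ∀ p ∈ ball p0 δ, ∃ x ∈ E, IsLocalMin (fun z => v z - inner ℝ p z) x) :
    volume (ball p0 δ) ≤ ∫⁻ x in E, (ENNReal.ofReal (ν⁻¹ * Lop a v x)) ^ d := by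
  set S : Set (Eu d) := {x ∈ ball (0 : Eu d) r | ∀ h : Eu d,
    0 ≤ ∑ i, ∑ j, pd2 i j v x * h i * h j} with hS
  have hSm : MeasurableSet S := by
    refine measurable_forall isOpen_ball _ fun h => ?_
    refine continuousOn_finset_sum _ fun i _ => continuousOn_finset_sum _ fun j _ => ?_
    exact ((pd2_continuousOn hv i j).mul continuousOn_const).mul continuousOn_const
  have hsub : ball p0 δ ⊆ Set.image (fun y => (WithLp.toLp 2 (fun i => pd i v y) : Eu d)) (E ∩ S) := by
    intro p hpm
    obtain ⟨x, hxE, hmin⟩ := hp p hpm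
    have hx := hEs hxE
    have hc := contDiffAt_of_ball hv hx
    have hc' : ContDiffAt ℝ 2 (fun z => v z - inner ℝ p z) x :=
      hc.sub (contDiffAt_const.inner ℝ contDiffAt_id)
    obtain ⟨h1, h2⟩ := localMin_second hc' hmin
    refine ⟨x, ⟨hxE, hx, fun h => ?_⟩, ?_⟩
    · have := h2 h
      simpa only [pd2_sub_inner p hc] using this
    · ext i
      have := h1 i
      rw [pd_sub_inner p (hc.differentiableAt (by norm_num))] at this
      simp only
      linarith
  calc volume (ball p0 δ) ≤ _ := measure_mono hsub
    _ ≤ ∫⁻ x in E ∩ S, ENNReal.ofReal |(gradJac v x).det| :=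
        addHaar_image_le_lintegral_abs_det_fderiv _ (hE.inter hSm)
          fun x hx => grad_hasFDerivAt (contDiffAt_of_ball hv hx.2.1) _
    _ ≤ ∫⁻ x in E ∩ S, (ENNReal.ofReal (ν⁻¹ * Lop a v x)) ^ d := by
        refine setLIntegral_mono' (hE.inter hSm) fun x hx => ?_
        obtain ⟨⟨f1, f2⟩, f3, -, f4⟩ := psd_facts (Matrix.of fun i j => pd2 i j v x)
          (fun i j => pd2_symm (contDiffAt_of_ball hv hx.2.1) i j) hx.2.2
        have f5 := f4 (fun i j => a i j x) ν (fun ξ => (hell x ξ).1)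
        rw [gradJac_det, abs_of_nonneg f1]
        have f6 : 0 ≤ ∑ i, pd2 i i v x := Finset.sum_nonneg fun i _ => f3 i
        have f7 : ∑ i, pd2 i i v x ≤ ν⁻¹ * Lop a v x := by
          rw [inv_mul_eq_div, le_div_iff₀ hν, mul_comm]
          exact f5
        rw [← ENNReal.ofReal_pow (f6.trans f7)]
        exact ENNReal.ofReal_le_ofReal (f2.trans (pow_le_pow_left₀ f6 f7 d))
    _ ≤ _ := lintegral_mono_set inter_subset_left


lemma vol_ball {d : ℕ} (x : Eu d) {δ : ℝ} (hδ : 0 < δ) :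
    volume (ball x δ) = ENNReal.ofReal (δ ^ d) * volume (ball (0 : Eu d) 1) := by
  rw [Measure.addHaar_ball_of_pos _ _ hδ, finrank_euclideanSpace_fin]

lemma vol_one_pos {d : ℕ} : volume (ball (0 : Eu d) 1) ≠ 0 :=
  (measure_ball_pos _ _ one_pos).ne'

lemma vol_one_fin {d : ℕ} : volume (ball (0 : Eu d) 1) ≠ ⊤ := measure_ball_lt_top.ne

lemma exists_min {d : ℕ} {r : ℝ} {u : Eu d → ℝ} (hu : ContinuousOn u (closedBall 0 r))
    {x0 : Eu d} (hx0 : x0 ∈ closedBall (0 : Eu d) r) {V : Set (Eu d)}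
    (hV : ∀ z ∈ closedBall (0 : Eu d) r, z ∉ V → u x0 < u z) :
    ∃ x ∈ closedBall (0 : Eu d) r, x ∈ V ∧ IsMinOn u (closedBall 0 r) x := by
  obtain ⟨x, hx, hmin⟩ := (isCompact_closedBall (0 : Eu d) r).exists_isMinOn ⟨x0, hx0⟩ hu
  refine ⟨x, hx, ?_, hmin⟩
  by_contra hxV
  exact absurd (hmin hx0) (not_le.2 (hV x hx hxV))

lemma isLocalMin_of_minOn {d : ℕ} {r : ℝ} {u : Eu d → ℝ} {x : Eu d}
    (hx : x ∈ ball (0 : Eu d) r) (h : IsMinOn u (closedBall 0 r) x) : IsLocalMin u x :=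
  h.isLocalMin (mem_of_superset (isOpen_ball.mem_nhds hx) ball_subset_closedBall)

lemma abp_aux {d : ℕ} (hd : d ≠ 0) {ν : ℝ} {a : Fin d → Fin d → Eu d → ℝ} (hν : 0 < ν)
    (hell : UnifElliptic d ν a) {r m : ℝ} (hr : 0 < r) (hm : 0 < m) {w : Eu d → ℝ}
    (hc : ContinuousOn w (closedBall 0 r))
    (hw : ContDiffOn ℝ 2 w (ball 0 r)) (h0 : ∀ x ∈ sphere (0 : Eu d) r, w x = 0)
    (hF : ∫⁻ x in ball (0 : Eu d) r, (ENNReal.ofReal |Lop a w x|) ^ d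
      ≤ ENNReal.ofReal (m ^ d) * volume (ball (0 : Eu d) r))
    {x0 : Eu d} (hx0 : x0 ∈ closedBall (0 : Eu d) r) : -w x0 ≤ 2 * m * r ^ 2 / ν := by
  by_contra! hlt
  set δ := -w x0 / (2 * r) with hδ
  have hδ1 : ν⁻¹ * m * r < δ := by
    rw [hδ, lt_div_iff₀ (by positivity)]
    calc ν⁻¹ * m * r * (2 * r) = 2 * m * r ^ 2 / ν := by field_simp
      _ < _ := hlt
  have hδ0 : 0 < δ := lt_trans (by positivity) hδ1
  have hdr : δ * (2 * r) = -w x0 := by rw [hδ]; field_simp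
  have key := area_est hν hell hw (E := ball 0 r) measurableSet_ball subset_rfl (p0 := 0) (δ := δ)
    (by
      intro p hp
      have hp' : ‖p‖ < δ := by simpa using hp
      have hcont : ContinuousOn (fun z => w z - inner ℝ p z) (closedBall (0 : Eu d) r) :=
        hc.sub (by fun_prop)
      obtain ⟨x, hx, hxV, hmin⟩ := exists_min hcont hx0 (V := ball 0 r) (by
        intro z hz hzV
        have hzs : ‖z‖ = r := by
          simp only [mem_closedBall, dist_zero_right, mem_ball, not_lt] at hz hzV
          exact le_antisymm hz hzV
        have hwz : w z = 0 := h0 z (by simpa using hzs)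
        have h1 : inner ℝ p z - inner ℝ p x0 ≤ ‖p‖ * (2 * r) := by
          rw [← inner_sub_right]
          refine (real_inner_le_norm _ _).trans ?_
          have : ‖x0‖ ≤ r := by simpa using hx0
          gcongr
          exact (norm_sub_le _ _).trans (by linarith)
        have h2 : ‖p‖ * (2 * r) < δ * (2 * r) := by gcongr
        simp only [hwz]
        linarith)
      exact ⟨x, hxV, isLocalMin_of_minOn hxV hmin⟩)
  have h2 : ∫⁻ x in ball (0 : Eu d) r, (ENNReal.ofReal (ν⁻¹ * Lop a w x)) ^ d
      ≤ ENNReal.ofReal ((ν⁻¹) ^ d) * (ENNReal.ofReal (m ^ d) * volume (ball (0 : Eu d) r)) := by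
    refine le_trans ?_ (mul_le_mul_right hF _)
    rw [← lintegral_const_mul' _ _ ENNReal.ofReal_ne_top]
    refine lintegral_mono fun x => ?_
    simp only
    rw [ENNReal.ofReal_pow (by positivity), ← mul_pow, ← ENNReal.ofReal_mul (by positivity)]
    gcongr
    exact le_abs_self _
  rw [vol_ball _ hδ0] at key
  rw [vol_ball _ hr, ← mul_assoc, ← mul_assoc, ← ENNReal.ofReal_mul (by positivity),
    ← ENNReal.ofReal_mul (by positivity)] at h2
  have h3 := (ENNReal.mul_le_mul_iff_left vol_one_pos vol_one_fin).1 (key.trans h2)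
  rw [ENNReal.ofReal_le_ofReal_iff (by positivity), ← mul_pow, ← mul_pow] at h3
  exact absurd h3 (not_le.2 (pow_lt_pow_left₀ hδ1 (by positivity) hd))

lemma abp {d : ℕ} (hd : d ≠ 0) {ν : ℝ} {a : Fin d → Fin d → Eu d → ℝ} (hν : 0 < ν)
    (hell : UnifElliptic d ν a) {r m : ℝ} (hr : 0 < r) (hm : 0 < m) {w : Eu d → ℝ}
    (hc : ContinuousOn w (closedBall 0 r))
    (hw : ContDiffOn ℝ 2 w (ball 0 r)) (h0 : ∀ x ∈ sphere (0 : Eu d) r, w x = 0)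
    (hF : ∫⁻ x in ball (0 : Eu d) r, (ENNReal.ofReal |Lop a w x|) ^ d
      ≤ ENNReal.ofReal (m ^ d) * volume (ball (0 : Eu d) r))
    {x0 : Eu d} (hx0 : x0 ∈ closedBall (0 : Eu d) r) : |w x0| ≤ 2 * m * r ^ 2 / ν := by
  have h1 := abp_aux hd hν hell hr hm hc hw h0 hF hx0
  have h2 := abp_aux hd hν hell hr hm (w := fun x => (-1) * w x) (continuousOn_const.mul hc)
    (contDiffOn_const.mul hw) (fun x hx => by simp [h0 x hx])
    (by
      refine le_trans (le_of_eq ?_) hF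
      refine setLIntegral_congr_fun measurableSet_ball fun x hx => ?_
      have : Lop a (fun x => (-1) * w x) x = - Lop a w x := by
        unfold Lop
        simp_rw [pd2_const_mul (-1) (contDiffAt_of_ball hw hx)]
        simp
      simp only [this, abs_neg]) hx0
  rw [abs_le]
  constructor <;> linarith

def touch {d : ℕ} (w : Eu d → ℝ) (r M : ℝ) : Set (Eu d) :=
  {x ∈ ball (0 : Eu d) r | ∃ q : Eu d,
    IsMinOn (fun z => (w z + M / 2 * ‖z‖ ^ 2) - inner ℝ q z) (closedBall 0 r) x}

lemma quad_contDiffAt {d : ℕ} {w : Eu d → ℝ} {x : Eu d} (hw : ContDiffAt ℝ 2 w x) (M : ℝ) :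
    ContDiffAt ℝ 2 (fun z => w z + M / 2 * ‖z‖ ^ 2) x :=
  hw.add (contDiffAt_const.mul (contDiffAt_id.norm_sq ℝ))

lemma quad_contDiffOn {d : ℕ} {w : Eu d → ℝ} {s : Set (Eu d)} (hw : ContDiffOn ℝ 2 w s) (M : ℝ) :
    ContDiffOn ℝ 2 (fun z => w z + M / 2 * ‖z‖ ^ 2) s :=
  hw.add (contDiffOn_const.mul (contDiffOn_id.norm_sq ℝ))

lemma touch_eq {d : ℕ} {w : Eu d → ℝ} {r : ℝ} (hw : ContDiffOn ℝ 2 w (ball 0 r)) (M : ℝ) :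
    touch w r M = {x ∈ ball (0 : Eu d) r | ∀ z : closedBall (0 : Eu d) r, 0 ≤
      ((w z + M / 2 * ‖(z : Eu d)‖ ^ 2) -
        ∑ i, pd i (fun z => w z + M / 2 * ‖z‖ ^ 2) x * (z : Eu d) i) -
      ((w x + M / 2 * ‖x‖ ^ 2) -
        ∑ i, pd i (fun z => w z + M / 2 * ‖z‖ ^ 2) x * x i)} := by
  have hin : ∀ q z : Eu d, inner ℝ q z = ∑ i, q i * z i := by
    intro q z; simp [PiLp.inner_apply, mul_comm]
  ext x
  constructor
  · rintro ⟨hx, q, hq⟩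
    refine ⟨hx, fun z => ?_⟩
    have hc := contDiffAt_of_ball hw hx
    have hc' := quad_contDiffAt hc M
    have hc'' : ContDiffAt ℝ 2 (fun z => (w z + M / 2 * ‖z‖ ^ 2) - inner ℝ q z) x :=
      hc'.sub (contDiffAt_const.inner ℝ contDiffAt_id)
    have h1 := (localMin_second hc'' (isLocalMin_of_minOn hx hq)).1
    have h2 : ∀ i, pd i (fun z => w z + M / 2 * ‖z‖ ^ 2) x = q i := by
      intro i
      have := h1 i
      rw [pd_sub_inner q (hc'.differentiableAt (by norm_num))] at this
      linarith
    simp_rw [h2, ← hin]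
    have := hq z.2
    simp only [mem_ofPred_eq] at this
    linarith
  · rintro ⟨hx, h⟩
    refine ⟨hx, WithLp.toLp 2 (fun i => pd i (fun z => w z + M / 2 * ‖z‖ ^ 2) x), fun z hz => ?_⟩
    have := h ⟨z, hz⟩
    simp only [mem_ofPred_eq, hin]
    linarith

lemma touch_cont {d : ℕ} {w : Eu d → ℝ} {r : ℝ} (hw : ContDiffOn ℝ 2 w (ball 0 r)) (M : ℝ)
    (z : closedBall (0 : Eu d) r) : ContinuousOn (fun x : Eu d =>
      ((w z + M / 2 * ‖(z : Eu d)‖ ^ 2) -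
        ∑ i, pd i (fun z => w z + M / 2 * ‖z‖ ^ 2) x * (z : Eu d) i) -
      ((w x + M / 2 * ‖x‖ ^ 2) -
        ∑ i, pd i (fun z => w z + M / 2 * ‖z‖ ^ 2) x * x i)) (ball 0 r) := by
  have h1 := fun i => pd_continuousOn (quad_contDiffOn hw M) i
  have h2 := hw.continuousOn
  refine (continuousOn_const.sub (continuousOn_finsetSum _ fun i _ =>
    (h1 i).mul continuousOn_const)).sub ((h2.add (by fun_prop)).sub
      (continuousOn_finsetSum _ fun i _ => (h1 i).mul (by fun_prop)))

lemma touch_meas {d : ℕ} {w : Eu d → ℝ} {r : ℝ} (hw : ContDiffOn ℝ 2 w (ball 0 r)) (M : ℝ) :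
    MeasurableSet (touch w r M) := by
  rw [touch_eq hw]
  exact measurable_forall isOpen_ball _ (touch_cont hw M)

lemma touch_open {d : ℕ} {w : Eu d → ℝ} {r : ℝ} (hw : ContDiffOn ℝ 2 w (ball 0 r)) (M : ℝ) :
    IsOpen (ball (0 : Eu d) r \ touch w r M) := by
  have h := isOpen_not_forall isOpen_ball _ (touch_cont hw M)
  rw [touch_eq hw]
  refine (congrArg IsOpen ?_).mp h
  ext x; simp only [mem_ofPred_eq, Set.mem_sdiff]; tauto

lemma trace_le {d : ℕ} {ν : ℝ} {a : Fin d → Fin d → Eu d → ℝ}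
    (hell : UnifElliptic d ν a) (x : Eu d) : ∑ i, a i i x ≤ d * ν⁻¹ := by
  have : ∀ i, a i i x ≤ ν⁻¹ := by
    intro i
    have := (hell x (Pi.single i 1)).2
    simpa [Pi.single_apply] using this
  calc ∑ i, a i i x ≤ ∑ i : Fin d, ν⁻¹ := Finset.sum_le_sum fun i _ => this i
    _ = _ := by simp

lemma touch_hess {d : ℕ} {ν : ℝ} {a : Fin d → Fin d → Eu d → ℝ} (hν : 0 < ν)
    (hell : UnifElliptic d ν a) {r M : ℝ} (hM : 0 < M) {w : Eu d → ℝ}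
    (hw : ContDiffOn ℝ 2 w (ball 0 r)) {x : Eu d} (hx : x ∈ touch w r M) :
    hessNorm w x ≤ d * (ν⁻¹ + ν⁻¹ * (d * ν⁻¹) + 1) * (M + |Lop a w x|) := by
  obtain ⟨hxb, q, hq⟩ := hx
  have hc := contDiffAt_of_ball hw hxb
  have hc' := quad_contDiffAt hc M
  have hc'' : ContDiffAt ℝ 2 (fun z => (w z + M / 2 * ‖z‖ ^ 2) - inner ℝ q z) x :=
    hc'.sub (contDiffAt_const.inner ℝ contDiffAt_id)
  have h1 := (localMin_second hc'' (isLocalMin_of_minOn hxb hq)).2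
  simp_rw [pd2_sub_inner q hc'] at h1
  have hpd2 : ∀ i j, pd2 i j (fun z => w z + M / 2 * ‖z‖ ^ 2) x
      = pd2 i j w x + if i = j then M else 0 := by
    intro i j
    have hn : ContDiffAt ℝ 2 (fun z : Eu d => ‖z‖ ^ 2) x := contDiffAt_id.norm_sq ℝ
    rw [pd2_add hc (contDiffAt_const.mul hn), pd2_const_mul _ hn]
    have := pd2_nsq 0 x i j
    simp only [sub_zero] at this
    rw [this]
    split_ifs <;> ring
  obtain ⟨-, f3, f2, f4⟩ := psd_facts (Matrix.of fun i j =>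
    pd2 i j (fun z => w z + M / 2 * ‖z‖ ^ 2) x) (fun i j => pd2_symm hc' i j) h1
  have f5 := f4 (fun i j => a i j x) ν (fun ξ => (hell x ξ).1)
  simp only [Matrix.of_apply] at f5 f2
  have hL : ∑ i, ∑ j, a i j x * pd2 i j (fun z => w z + M / 2 * ‖z‖ ^ 2) x
      = Lop a w x + M * ∑ i, a i i x := by
    simp_rw [hpd2, mul_add, Finset.sum_add_distrib]
    simp [Lop, Finset.mul_sum, mul_comm]
  rw [hL] at f5
  set T := ∑ i, pd2 i i (fun z => w z + M / 2 * ‖z‖ ^ 2) x with hT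
  have ht := trace_le hell x
  have hT1 : T ≤ ν⁻¹ * (|Lop a w x| + M * (d * ν⁻¹)) := by
    rw [inv_mul_eq_div, le_div_iff₀ hν, mul_comm]
    refine f5.trans ?_
    gcongr
    exact le_abs_self _
  have hT2 : T + M ≤ (ν⁻¹ + ν⁻¹ * (d * ν⁻¹) + 1) * (M + |Lop a w x|) := by
    have p1 : 0 ≤ ν⁻¹ * M := by positivity
    have p2 : 0 ≤ ν⁻¹ * (d * ν⁻¹) * |Lop a w x| := by positivity
    have p3 := abs_nonneg (Lop a w x)
    nlinarith
  have hT0 : 0 ≤ T := Finset.sum_nonneg fun i _ => f3 i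
  have hent : ∀ i j, |pd2 i j w x| ≤ T + M := by
    intro i j
    have h5 := f2 i j
    rw [hpd2] at h5
    have h6 : |if i = j then M else 0| ≤ M := by
      split_ifs
      · rw [abs_of_pos hM]
      · simpa using hM.le
    rw [abs_le] at h5 h6 ⊢
    constructor <;> linarith [h5.1, h5.2, h6.1, h6.2]
  have hfin : hessNorm w x ≤ d * (T + M) := by
    unfold hessNorm
    apply Real.sqrt_le_iff.2
    refine ⟨by positivity, ?_⟩
    calc ∑ i, ∑ j, pd2 i j w x ^ 2 ≤ ∑ i : Fin d, ∑ j : Fin d, (T + M) ^ 2 :=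
          Finset.sum_le_sum fun i _ => Finset.sum_le_sum fun j _ => by
            rw [← sq_abs]
            exact pow_le_pow_left₀ (abs_nonneg _) (hent i j) 2
      _ = _ := by simp; ring
  refine hfin.trans ?_
  rw [mul_assoc]
  gcongr


lemma touch_mono {d : ℕ} {w : Eu d → ℝ} {r M M' : ℝ} (h : M ≤ M') :
    touch w r M ⊆ touch w r M' := by
  rintro x ⟨hx, q, hq⟩
  refine ⟨hx, q + (M' - M) • x, fun z hz => ?_⟩
  have h1 := hq hz
  simp only [mem_ofPred_eq] at h1 ⊢
  have h2 : 0 ≤ (M' - M) / 2 * ‖z - x‖ ^ 2 := by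
    have : 0 ≤ M' - M := by linarith
    positivity
  rw [norm_sub_sq_real] at h2
  simp only [inner_add_left, real_inner_smul_left, real_inner_self_eq_norm_sq]
  rw [real_inner_comm] at h2
  linarith

lemma touch_nonempty {d : ℕ} {w : Eu d → ℝ} {r M S ρ : ℝ} (hc : ContinuousOn w (closedBall 0 r))
    (hS : ∀ x ∈ closedBall (0 : Eu d) r, |w x| ≤ S) (hρ : 0 < ρ) (hM : 0 < M)
    (hMρ : 2 * S < M * ρ ^ 2 / 8)
    {y : Eu d} (hy : ball y ρ ⊆ ball 0 r) : ∃ x ∈ touch w r M, dist x y < ρ / 2 := by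
  have hyb : y ∈ ball (0 : Eu d) r := hy (mem_ball_self hρ)
  have hcont : ContinuousOn (fun z => (w z + M / 2 * ‖z‖ ^ 2) - inner ℝ (M • y) z)
      (closedBall (0 : Eu d) r) := (hc.add (by fun_prop)).sub (by fun_prop)
  obtain ⟨x, hx, hxV, hmin⟩ := exists_min hcont (ball_subset_closedBall hyb) (V := ball y (ρ / 2)) (by
    intro z hz hzV
    have h1 : ρ / 2 ≤ ‖z - y‖ := by
      rw [mem_ball, not_lt, dist_eq_norm] at hzV; exact hzV
    have h2 : (ρ / 2) ^ 2 ≤ ‖z - y‖ ^ 2 := pow_le_pow_left₀ (by positivity) h1 2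
    rw [norm_sub_sq_real, real_inner_comm] at h2
    have h3 := (abs_le.1 (hS z hz)).1
    have h4 := (abs_le.1 (hS y (ball_subset_closedBall hyb))).2
    simp only [real_inner_smul_left, real_inner_self_eq_norm_sq]
    nlinarith)
  exact ⟨x, ⟨hy (ball_subset_ball (by linarith) hxV), M • y, hmin⟩, hxV⟩

def betaC (d : ℕ) (ν : ℝ) : ℝ := d / ν ^ 2
def KC (d : ℕ) (ν : ℝ) : ℝ := 3 * Real.exp (4 * betaC d ν)
def LamC (d : ℕ) (ν : ℝ) : ℝ := 3 + 2 * KC d ν * betaC d ν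

lemma betaC_pos {d : ℕ} (hd : d ≠ 0) {ν : ℝ} (hν : 0 < ν) : 0 < betaC d ν := by
  have : 0 < d := Nat.pos_of_ne_zero hd
  unfold betaC; positivity

lemma KC_pos {d : ℕ} {ν : ℝ} : 0 < KC d ν := by unfold KC; positivity

lemma LamC_ge {d : ℕ} (hd : d ≠ 0) {ν : ℝ} (hν : 0 < ν) : 3 ≤ LamC d ν := by
  have := betaC_pos hd hν
  have := KC_pos (d := d) (ν := ν)
  unfold LamC
  have : 0 < KC d ν * betaC d ν := by positivity
  linarith

def bump {d : ℕ} (K M t β : ℝ) (y0 : Eu d) (w : Eu d → ℝ) (z : Eu d) : ℝ :=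
  (w z + M / 2 * ‖z‖ ^ 2) + (M * ‖z - y0‖ ^ 2 +
    (-(K * M * t ^ 2)) * Real.exp (-(β / t ^ 2) * ‖z - y0‖ ^ 2))

lemma nsq_contDiff {d : ℕ} (y0 : Eu d) : ContDiff ℝ 2 (fun z : Eu d => ‖z - y0‖ ^ 2) :=
  (contDiff_id.sub contDiff_const).norm_sq ℝ

lemma gexp_contDiff {d : ℕ} (b : ℝ) (y0 : Eu d) :
    ContDiff ℝ 2 (fun z : Eu d => Real.exp (-b * ‖z - y0‖ ^ 2)) :=
  (contDiff_const.mul (nsq_contDiff y0)).exp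

lemma bump_contDiffOn {d : ℕ} (K M t β : ℝ) (y0 : Eu d) {w : Eu d → ℝ} {s : Set (Eu d)}
    (hw : ContDiffOn ℝ 2 w s) : ContDiffOn ℝ 2 (bump K M t β y0 w) s := by
  unfold bump
  exact (quad_contDiffOn hw M).add ((contDiff_const.mul (nsq_contDiff y0)).add
    (contDiff_const.mul (gexp_contDiff _ y0))).contDiffOn

lemma bump_Lop {d : ℕ} (K M t β : ℝ) (ht : 0 < t) (y0 : Eu d) {w : Eu d → ℝ} {x : Eu d}
    (hw : ContDiffAt ℝ 2 w x) (a : Fin d → Fin d → Eu d → ℝ) :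
    Lop a (bump K M t β y0 w) x = Lop a w x + 3 * M * ∑ i, a i i x
      - K * M * Real.exp (-(β / t ^ 2) * ‖x - y0‖ ^ 2) * (-2 * β * ∑ i, a i i x +
        4 * β ^ 2 / t ^ 2 * ∑ i, ∑ j, a i j x * (x i - y0 i) * (x j - y0 j)) := by
  have hpd2 : ∀ i j, pd2 i j (bump K M t β y0 w) x = pd2 i j w x + ((if i = j then 3 * M else 0)
      + (-(K * M * Real.exp (-(β / t ^ 2) * ‖x - y0‖ ^ 2))) * ((if i = j then -2 * β else 0)
        + 4 * β ^ 2 / t ^ 2 * ((x i - y0 i) * (x j - y0 j)))) := by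
    intro i j
    have hn : ContDiffAt ℝ 2 (fun z : Eu d => ‖z‖ ^ 2) x := contDiffAt_id.norm_sq ℝ
    have hn2 := (nsq_contDiff y0).contDiffAt (x := x)
    have hn3 := (gexp_contDiff (β / t ^ 2) y0).contDiffAt (x := x)
    unfold bump
    rw [pd2_add (quad_contDiffAt hw M) ((contDiffAt_const.mul hn2).add (contDiffAt_const.mul hn3)),
      pd2_add hw (contDiffAt_const.mul hn), pd2_const_mul _ hn,
      pd2_add (contDiffAt_const.mul hn2) (contDiffAt_const.mul hn3), pd2_const_mul _ hn2,
      pd2_const_mul _ hn3, pd2_nsq, pd2_gexp]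
    have := pd2_nsq 0 x i j
    simp only [sub_zero] at this
    rw [this]
    split_ifs
    · field_simp
      ring
    · field_simp
      ring
  unfold Lop
  simp_rw [hpd2, mul_add, Finset.sum_add_distrib]
  have e1 : ∑ i, ∑ j, a i j x * (if i = j then 3 * M else 0) = 3 * M * ∑ i, a i i x := by
    simp [Finset.mul_sum, mul_comm]
  set e := Real.exp (-(β / t ^ 2) * ‖x - y0‖ ^ 2)
  have e2 : ∑ i, ∑ j, a i j x * (-(K * M * e) * (if i = j then -2 * β else 0))
      = -(K * M * e) * (-2 * β * ∑ i, a i i x) := by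
    simp [Finset.mul_sum]
    refine Finset.sum_congr rfl fun i _ => by ring
  have e3 : ∑ i, ∑ j, a i j x * (-(K * M * e) * (4 * β ^ 2 / t ^ 2 * ((x i - y0 i) * (x j - y0 j))))
      = -(K * M * e) * (4 * β ^ 2 / t ^ 2 *
        ∑ i, ∑ j, a i j x * (x i - y0 i) * (x j - y0 j)) := by
    simp only [Finset.mul_sum]
    refine Finset.sum_congr rfl fun i _ => Finset.sum_congr rfl fun j _ => by ring
  rw [e1, e2, e3]
  ring

lemma bump_Lop_le {d : ℕ} (hd : d ≠ 0) {ν : ℝ} (hν : 0 < ν) (hν1 : ν ≤ 1) {M t : ℝ} (hM : 0 < M)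
    (ht : 0 < t) {y0 : Eu d} {w : Eu d → ℝ} {x : Eu d}
    (hw : ContDiffAt ℝ 2 w x) {a : Fin d → Fin d → Eu d → ℝ} (hell : UnifElliptic d ν a)
    (hx2 : ‖x - y0‖ ≤ 2 * t) :
    Lop a (bump (KC d ν) M t (betaC d ν) y0 w) x ≤ |Lop a w x| + d * ν⁻¹ * LamC d ν * M ∧
    (t ≤ ‖x - y0‖ → Lop a (bump (KC d ν) M t (betaC d ν) y0 w) x ≤ |Lop a w x|) := by
  rw [bump_Lop _ _ _ _ ht _ hw]
  have hβ := betaC_pos hd hν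
  have hK := KC_pos (d := d) (ν := ν)
  have htr := trace_le hell x
  set β := betaC d ν with hβd
  set K := KC d ν with hKd
  set e := Real.exp (-(β / t ^ 2) * ‖x - y0‖ ^ 2) with he
  set A := ∑ i, a i i x with hA
  set Q := ∑ i, ∑ j, a i j x * (x i - y0 i) * (x j - y0 j) with hQ
  have hQge : ν * ‖x - y0‖ ^ 2 ≤ Q := by
    have := (hell x (fun i => x i - y0 i)).1
    rw [EuclideanSpace.norm_sq_eq]
    simpa using this
  have hQ0 : 0 ≤ Q := le_trans (by positivity) hQge
  have he0 : 0 < e := Real.exp_pos _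
  have he1 : e ≤ 1 := by
    apply Real.exp_le_one_iff.2
    have : 0 ≤ β / t ^ 2 * ‖x - y0‖ ^ 2 := by positivity
    linarith
  have habs := le_abs_self (Lop a w x)
  have hKM : 0 < K * M := by positivity
  have hd0 : (1:ℝ) ≤ d := by exact_mod_cast Nat.one_le_iff_ne_zero.2 hd
  constructor
  · have h1 : 3 * M * A ≤ 3 * M * (d * ν⁻¹) := by gcongr
    have h2 : K * M * e * (2 * β * A) ≤ K * M * 1 * (2 * β * (d * ν⁻¹)) := by
      have hdn : 0 ≤ 2 * β * (d * ν⁻¹) := by positivity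
      calc K * M * e * (2 * β * A) ≤ K * M * e * (2 * β * (d * ν⁻¹)) := by gcongr
        _ ≤ _ := by gcongr
    have h3 : 0 ≤ K * M * e * (4 * β ^ 2 / t ^ 2 * Q) := by positivity
    have h4 : d * ν⁻¹ * LamC d ν * M = 3 * M * (d * ν⁻¹) + K * M * 1 * (2 * β * (d * ν⁻¹)) := by
      unfold LamC; rw [← hβd, ← hKd]; ring
    rw [h4]
    linarith
  · intro hxt
    have hb : 2 * (d * ν⁻¹) * β ≤ -2 * β * A + 4 * β ^ 2 / t ^ 2 * Q := by
      have h1 : t ^ 2 ≤ ‖x - y0‖ ^ 2 := pow_le_pow_left₀ ht.le hxt 2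
      have h2 : 4 * β ^ 2 / t ^ 2 * (ν * t ^ 2) ≤ 4 * β ^ 2 / t ^ 2 * Q := by
        have : ν * t ^ 2 ≤ Q := le_trans (by gcongr) hQge
        gcongr
      have h3 : 4 * β ^ 2 / t ^ 2 * (ν * t ^ 2) = 4 * (d * ν⁻¹) * β := by
        have : β * ν = d * ν⁻¹ := by rw [hβd]; unfold betaC; field_simp
        rw [← this]; field_simp
      have h4 : 2 * β * A ≤ 2 * β * (d * ν⁻¹) := by gcongr
      linarith
    have hee : Real.exp (-(4 * β)) ≤ e := by
      apply Real.exp_le_exp.2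
      have h1 : ‖x - y0‖ ^ 2 ≤ (2 * t) ^ 2 := pow_le_pow_left₀ (norm_nonneg _) hx2 2
      have h2 : β / t ^ 2 * ‖x - y0‖ ^ 2 ≤ β / t ^ 2 * (2 * t) ^ 2 := by gcongr
      have h3 : β / t ^ 2 * (2 * t) ^ 2 = 4 * β := by field_simp; ring
      linarith
    have hKe : 3 ≤ K * e := by
      have : K * Real.exp (-(4 * β)) = 3 := by
        rw [hKd]; unfold KC; rw [← hβd, mul_assoc, ← Real.exp_add]; simp
      calc 3 = K * Real.exp (-(4 * β)) := this.symm
        _ ≤ _ := by gcongr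
    have hβ1 : 1 ≤ β := by
      rw [hβd]; unfold betaC
      rw [le_div_iff₀ (by positivity)]
      nlinarith
    have hpos : 0 < d * ν⁻¹ := by positivity
    have h5 : 3 * M * A ≤ 3 * M * (d * ν⁻¹) := by gcongr
    have h6 : 3 * M * (d * ν⁻¹) ≤ K * M * e * (-2 * β * A + 4 * β ^ 2 / t ^ 2 * Q) := by
      have h7 : d * ν⁻¹ ≤ 2 * (d * ν⁻¹) * β := by nlinarith
      calc 3 * M * (d * ν⁻¹) ≤ 3 * M * (2 * (d * ν⁻¹) * β) :=
            mul_le_mul_of_nonneg_left h7 (by positivity)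
        _ ≤ (K * e) * M * (2 * (d * ν⁻¹) * β) := by gcongr
        _ = K * M * e * (2 * (d * ν⁻¹) * β) := by ring
        _ ≤ _ := by gcongr
    linarith


lemma key_contact {d : ℕ} (hd : d ≠ 0) {ν : ℝ} (hν : 0 < ν) {r M t : ℝ}
    (hM : 0 < M) (ht : 0 < t) {y0 x1 : Eu d} {w : Eu d → ℝ}
    (hc : ContinuousOn w (closedBall 0 r))
    (hb : ball y0 (2 * t) ⊆ ball 0 r) {q1 : Eu d} (hx1b : x1 ∈ ball (0 : Eu d) r)
    (hq1 : IsMinOn (fun z => (w z + M / 2 * ‖z‖ ^ 2) - inner ℝ q1 z) (closedBall 0 r) x1)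
    (hx1 : ‖x1 - y0‖ < 3 / 2 * t) {p : Eu d} (hp : p ∈ ball q1 (M * t / 4)) :
    ∃ x ∈ touch w r (LamC d ν * M) ∩ ball y0 (2 * t),
      IsLocalMin (fun z => bump (KC d ν) M t (betaC d ν) y0 w z - inner ℝ p z) x := by
  have hβ := betaC_pos hd hν
  have hK := KC_pos (d := d) (ν := ν)
  set β := betaC d ν with hβd
  set K := KC d ν with hKd
  have hcont : ContinuousOn (fun z => bump K M t β y0 w z - inner ℝ p z)
      (closedBall (0 : Eu d) r) := by
    unfold bump
    exact ((hc.add (by fun_prop)).add (by fun_prop)).sub (by fun_prop)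
  obtain ⟨x, hx, hxV, hmin⟩ := exists_min hcont (ball_subset_closedBall hx1b)
    (V := ball y0 (2 * t)) (by
    intro z hz hzV
    have hZ : 2 * t ≤ ‖z - y0‖ := by
      rw [mem_ball, not_lt, dist_eq_norm] at hzV; exact hzV
    have hq := hq1 hz
    simp only [mem_ofPred_eq] at hq
    have hp' : ‖p - q1‖ < M * t / 4 := by rwa [mem_ball, dist_eq_norm] at hp
    have hX0 := norm_nonneg (x1 - y0)
    have h1 : inner ℝ (p - q1) z - inner ℝ (p - q1) x1
        ≤ M * t / 4 * (‖z - y0‖ + ‖x1 - y0‖) := by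
      rw [← inner_sub_right]
      refine (real_inner_le_norm _ _).trans ?_
      have : ‖z - x1‖ ≤ ‖z - y0‖ + ‖x1 - y0‖ := by
        have := norm_sub_le (z - y0) (x1 - y0)
        simpa using this
      gcongr
    rw [inner_sub_left, inner_sub_left] at h1
    have h2 : M * t / 4 * (‖z - y0‖ + ‖x1 - y0‖) < M * (‖z - y0‖ ^ 2 - ‖x1 - y0‖ ^ 2) := by
      have e : ‖z - y0‖ ^ 2 - ‖x1 - y0‖ ^ 2
        = (‖z - y0‖ - ‖x1 - y0‖) * (‖z - y0‖ + ‖x1 - y0‖) := by ring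
      rw [e]
      have h3 : t / 4 < ‖z - y0‖ - ‖x1 - y0‖ := by linarith
      have h4 : 0 < ‖z - y0‖ + ‖x1 - y0‖ := by linarith
      calc M * t / 4 * (‖z - y0‖ + ‖x1 - y0‖) = M * (t / 4 * (‖z - y0‖ + ‖x1 - y0‖)) := by ring
        _ < _ := by gcongr
    have h5 : Real.exp (-(β / t ^ 2) * ‖z - y0‖ ^ 2) ≤ Real.exp (-(β / t ^ 2) * ‖x1 - y0‖ ^ 2) := by
      apply Real.exp_le_exp.2
      have : β / t ^ 2 * ‖x1 - y0‖ ^ 2 ≤ β / t ^ 2 * ‖z - y0‖ ^ 2 := by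
        gcongr
        linarith
      linarith
    have h6 := mul_le_mul_of_nonneg_left h5 (show 0 ≤ K * M * t ^ 2 by positivity)
    unfold bump
    linarith)
  refine ⟨x, ⟨?_, hxV⟩, isLocalMin_of_minOn (hb hxV) hmin⟩
  set e := Real.exp (-(β / t ^ 2) * ‖x - y0‖ ^ 2) with he
  have he0 : 0 < e := Real.exp_pos _
  have he1 : e ≤ 1 := by
    apply Real.exp_le_one_iff.2
    have : 0 ≤ β / t ^ 2 * ‖x - y0‖ ^ 2 := by positivity
    linarith
  have hle : 3 * M + 2 * (K * M * β * e) ≤ LamC d ν * M := by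
    unfold LamC
    rw [← hβd, ← hKd]
    have : K * M * β * e ≤ K * M * β * 1 := by gcongr
    linarith
  refine touch_mono hle ⟨hb hxV, p + (2 * (M + K * M * β * e)) • y0, fun z hz => ?_⟩
  have hz1 := hmin hz
  simp only [mem_ofPred_eq, inner_add_left, real_inner_smul_left] at hz1 ⊢
  unfold bump at hz1
  rw [← he] at hz1
  have h7 : e - β / t ^ 2 * e * (‖z - y0‖ ^ 2 - ‖x - y0‖ ^ 2)
      ≤ Real.exp (-(β / t ^ 2) * ‖z - y0‖ ^ 2) := by
    have h8 := Real.add_one_le_exp (-(β / t ^ 2) * (‖z - y0‖ ^ 2 - ‖x - y0‖ ^ 2))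
    have h9 : Real.exp (-(β / t ^ 2) * ‖z - y0‖ ^ 2)
        = e * Real.exp (-(β / t ^ 2) * (‖z - y0‖ ^ 2 - ‖x - y0‖ ^ 2)) := by
      rw [he, ← Real.exp_add]; congr 1; ring
    rw [h9]
    have := mul_le_mul_of_nonneg_left h8 he0.le
    linarith
  have h10 := mul_le_mul_of_nonneg_left h7 (show 0 ≤ K * M * t ^ 2 by positivity)
  have h11 : K * M * t ^ 2 * (e - β / t ^ 2 * e * (‖z - y0‖ ^ 2 - ‖x - y0‖ ^ 2))
      = K * M * t ^ 2 * e - (K * M * β * e) * (‖z - y0‖ ^ 2 - ‖x - y0‖ ^ 2) := by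
    field_simp
  rw [h11] at h10
  rw [norm_sub_sq_real z y0, norm_sub_sq_real x y0, real_inner_comm y0 z, real_inner_comm y0 x] at hz1 h10
  linarith

def C3 (d : ℕ) (ν : ℝ) : ℝ :=
  4 ^ d * ((1 + 2 ^ d) * ((ν⁻¹) ^ d * (1 + (d * ν⁻¹ * LamC d ν) ^ d)))

lemma C3_pos {d : ℕ} (hd : d ≠ 0) {ν : ℝ} (hν : 0 < ν) : 0 < C3 d ν := by
  have := LamC_ge hd hν
  have h : 0 ≤ LamC d ν := by linarith
  unfold C3; positivity

lemma key_est {d : ℕ} (hd : d ≠ 0) {ν : ℝ} (hν : 0 < ν) (hν1 : ν ≤ 1) {r M t : ℝ}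
    (hM : 0 < M) (ht : 0 < t) {y0 x1 : Eu d} {w : Eu d → ℝ}
    {a : Fin d → Fin d → Eu d → ℝ} (hell : UnifElliptic d ν a)
    (hc : ContinuousOn w (closedBall 0 r)) (hw : ContDiffOn ℝ 2 w (ball 0 r))
    (hb : ball y0 (2 * t) ⊆ ball 0 r) (hx1t : x1 ∈ touch w r M)
    (hx1 : ‖x1 - y0‖ < 3 / 2 * t) :
    ENNReal.ofReal (M ^ d) * volume (ball y0 t) ≤ ENNReal.ofReal (C3 d ν) *
      ((∫⁻ x in ball y0 (2 * t), (ENNReal.ofReal |Lop a w x|) ^ d) +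
        ENNReal.ofReal (M ^ d) * volume (touch w r (LamC d ν * M) ∩ ball y0 t)) := by
  obtain ⟨hx1b, q1, hq1⟩ := hx1t
  have hL := LamC_ge hd hν
  have hL0 : 0 ≤ LamC d ν := by linarith
  set v := bump (KC d ν) M t (betaC d ν) y0 w with hv
  set T := touch w r (LamC d ν * M) with hT
  have hTm : MeasurableSet T := touch_meas hw _
  have key := area_est hν hell (bump_contDiffOn (KC d ν) M t (betaC d ν) y0 hw)
    (E := T ∩ ball y0 (2 * t)) (hTm.inter measurableSet_ball)
    (inter_subset_right.trans hb) (p0 := q1) (δ := M * t / 4)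
    (fun p hp => key_contact hd hν hM ht hc hb hx1b hq1 hx1 hp)
  rw [← hv] at key
  set c1 := d * ν⁻¹ * LamC d ν with hc1
  have hc10 : 0 ≤ c1 := by positivity
  set I := ∫⁻ x in ball y0 (2 * t), (ENNReal.ofReal |Lop a w x|) ^ d with hI
  have hup : ∫⁻ x in T ∩ ball y0 (2 * t), (ENNReal.ofReal (ν⁻¹ * Lop a v x)) ^ d
      ≤ ENNReal.ofReal ((ν⁻¹) ^ d) * I + (ENNReal.ofReal ((ν⁻¹) ^ d) * (2 ^ d * (I +
        ENNReal.ofReal ((c1 * M) ^ d) * volume (T ∩ ball y0 t)))) := by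
    have hsplit : T ∩ ball y0 (2 * t) ⊆ ((T ∩ ball y0 (2 * t)) \ ball y0 t) ∪ (T ∩ ball y0 t) := by
      rintro x ⟨h1, h2⟩
      by_cases h : x ∈ ball y0 t
      · exact Or.inr ⟨h1, h⟩
      · exact Or.inl ⟨⟨h1, h2⟩, h⟩
    refine (lintegral_mono_set hsplit).trans ((lintegral_union_le _ _ _).trans ?_)
    refine add_le_add ?_ ?_
    · rw [hI, ← lintegral_const_mul' _ _ ENNReal.ofReal_ne_top]
      refine le_trans ?_ (lintegral_mono_set (s := (T ∩ ball y0 (2 * t)) \ ball y0 t)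
        (fun x hx => hx.1.2))
      refine setLIntegral_mono' ((hTm.inter measurableSet_ball).diff measurableSet_ball)
        fun x hx => ?_
      rw [ENNReal.ofReal_pow (by positivity), ← mul_pow, ← ENNReal.ofReal_mul (by positivity)]
      have h1 : ‖x - y0‖ < 2 * t := by simpa [dist_eq_norm] using hx.1.2
      have h2 : t ≤ ‖x - y0‖ := by simpa [dist_eq_norm] using hx.2
      have := (bump_Lop_le hd hν hν1 hM ht (contDiffAt_of_ball hw (hb hx.1.2)) hell h1.le).2 h2
      gcongr
    · have hbb : ball y0 t ⊆ ball y0 (2 * t) := ball_subset_ball (by linarith)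
      have hI2 : ∫⁻ x in T ∩ ball y0 t, (ENNReal.ofReal |Lop a w x|) ^ d ≤ I :=
        lintegral_mono_set (inter_subset_right.trans hbb)
      refine le_trans ?_ (mul_le_mul_right (mul_le_mul_right (add_le_add_left hI2 _) _) _)
      rw [← setLIntegral_const, ← lintegral_add_right _ measurable_const,
        ← lintegral_const_mul' _ _ (by simp), ← lintegral_const_mul' _ _ ENNReal.ofReal_ne_top]
      refine setLIntegral_mono' (hTm.inter measurableSet_ball) fun x hx => ?_
      have h1 : ‖x - y0‖ < t := by simpa [dist_eq_norm] using hx.2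
      have h3 := (bump_Lop_le hd hν hν1 hM ht (contDiffAt_of_ball hw (hb (hbb hx.2))) hell
        (by linarith : ‖x - y0‖ ≤ 2 * t)).1
      rw [ENNReal.ofReal_pow (by positivity), ENNReal.ofReal_pow (by positivity)]
      calc ENNReal.ofReal (ν⁻¹ * Lop a v x) ^ d
          ≤ (ENNReal.ofReal (ν⁻¹) * (ENNReal.ofReal |Lop a w x| + ENNReal.ofReal (c1 * M))) ^ d := by
            rw [← ENNReal.ofReal_add (by positivity) (by positivity),
              ← ENNReal.ofReal_mul (by positivity)]
            gcongr
        _ ≤ _ := by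
            rw [mul_pow]
            gcongr
            calc (ENNReal.ofReal |Lop a w x| + ENNReal.ofReal (c1 * M)) ^ d
                ≤ (2 * max (ENNReal.ofReal |Lop a w x|) (ENNReal.ofReal (c1 * M))) ^ d := by
                  gcongr
                  rw [two_mul]
                  exact add_le_add (le_max_left _ _) (le_max_right _ _)
              _ = 2 ^ d * max (ENNReal.ofReal |Lop a w x|) (ENNReal.ofReal (c1 * M)) ^ d := mul_pow _ _ _
              _ ≤ _ := by
                  gcongr
                  rcases le_total (ENNReal.ofReal |Lop a w x|) (ENNReal.ofReal (c1 * M)) with h | h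
                  · rw [max_eq_right h]; exact le_add_self
                  · rw [max_eq_left h]; exact le_self_add
  have h1 := key.trans hup
  rw [vol_ball _ (by positivity : 0 < M * t / 4)] at h1
  rw [vol_ball _ ht]
  set ω := volume (ball (0 : Eu d) 1)
  set J := ENNReal.ofReal (M ^ d) * volume (T ∩ ball y0 t) with hJ
  have e1 : ENNReal.ofReal ((c1 * M) ^ d) * volume (T ∩ ball y0 t)
      = ENNReal.ofReal (c1 ^ d) * J := by
    rw [hJ, ← mul_assoc, ← ENNReal.ofReal_mul (by positivity), mul_pow]
  rw [e1] at h1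
  have e2 : ENNReal.ofReal (M ^ d) * (ENNReal.ofReal (t ^ d) * ω)
      = ENNReal.ofReal (4 ^ d) * (ENNReal.ofReal ((M * t / 4) ^ d) * ω) := by
    rw [← mul_assoc, ← mul_assoc, ← ENNReal.ofReal_mul (by positivity),
      ← ENNReal.ofReal_mul (by positivity), ← mul_pow, ← mul_pow]
    congr 3; ring
  rw [e2]
  refine (mul_le_mul_right h1 _).trans ?_
  have e3 : ENNReal.ofReal (C3 d ν) = ENNReal.ofReal (4 ^ d) * ((1 + 2 ^ d) *
      (ENNReal.ofReal ((ν⁻¹) ^ d) * (1 + ENNReal.ofReal (c1 ^ d)))) := by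
    unfold C3
    rw [← hc1, ENNReal.ofReal_mul (by positivity), ENNReal.ofReal_mul (by positivity),
      ENNReal.ofReal_mul (by positivity), ENNReal.ofReal_add (by positivity) (by positivity),
      ENNReal.ofReal_add (by positivity) (by positivity),
      ENNReal.ofReal_pow (by positivity : (0:ℝ) ≤ 2)]
    simp
  rw [e3, mul_assoc]
  gcongr
  set A := ENNReal.ofReal ((ν⁻¹) ^ d)
  set B := ENNReal.ofReal (c1 ^ d)
  have hin1 : I ≤ (1 + B) * (I + J) := by
    calc I ≤ 1 * (I + J) := by rw [one_mul]; exact le_self_add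
      _ ≤ _ := by gcongr; exact le_self_add
  have hin2 : I + B * J ≤ (1 + B) * (I + J) := by
    have : (1 + B) * (I + J) = (I + B * J) + (J + B * I) := by ring
    rw [this]; exact le_self_add
  calc A * I + A * (2 ^ d * (I + B * J))
      ≤ A * ((1 + B) * (I + J)) + A * (2 ^ d * ((1 + B) * (I + J))) := by gcongr
    _ = _ := by ring


lemma vitali_pt {d : ℕ} {r M S : ℝ}
    (hM : 0 < M) {w : Eu d → ℝ}
    (hc : ContinuousOn w (closedBall 0 r)) (hw : ContDiffOn ℝ 2 w (ball 0 r))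
    (hS : ∀ x ∈ closedBall (0 : Eu d) r, |w x| ≤ S) {y : Eu d}
    (hy : y ∈ ball (0 : Eu d) r \ touch w r M) (hy2 : 2 * S < M * (r - ‖y‖) ^ 2 / 8) :
    0 < infDist y (touch w r M) ∧ infDist y (touch w r M) ≤ r ∧
      ball y (2 * infDist y (touch w r M)) ⊆ ball 0 r ∧
      (∃ x1 ∈ touch w r M, ‖x1 - y‖ < 3 / 2 * infDist y (touch w r M)) ∧
      Disjoint (ball y (infDist y (touch w r M))) (touch w r M) := by
  have hyn : ‖y‖ < r := by simpa using hy.1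
  have hsub : ∀ s, s ≤ r - ‖y‖ → ball y s ⊆ ball (0 : Eu d) r := by
    intro s hs
    apply ball_subset_ball'
    rw [dist_zero_right]; linarith
  obtain ⟨x, hx, hxd⟩ := touch_nonempty hc hS (by linarith : 0 < r - ‖y‖) hM hy2 (hsub _ le_rfl)
  have hne : (touch w r M).Nonempty := ⟨x, hx⟩
  have h1 : infDist y (touch w r M) < (r - ‖y‖) / 2 :=
    lt_of_le_of_lt (infDist_le_dist_of_mem hx) (by rwa [dist_comm])
  have hpos : 0 < infDist y (touch w r M) := by
    obtain ⟨δ, hδ, hb⟩ := Metric.isOpen_iff.1 (touch_open hw M) y hy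
    refine lt_of_lt_of_le hδ ((le_infDist hne).2 fun z hz => ?_)
    by_contra hlt
    exact (hb (show z ∈ ball y δ by rw [mem_ball, dist_comm]; exact not_le.1 hlt)).2 hz
  refine ⟨hpos, by linarith [norm_nonneg y], hsub _ (by linarith), ?_, disjoint_ball_infDist⟩
  obtain ⟨z, hz, hzd⟩ := (infDist_lt_iff hne).1 (show infDist y (touch w r M) <
    3 / 2 * infDist y (touch w r M) by linarith)
  exact ⟨z, hz, by rwa [← dist_eq_norm, dist_comm]⟩

lemma vitali_step {d : ℕ} (hd : d ≠ 0) {ν : ℝ} (hν : 0 < ν) (hν1 : ν ≤ 1) {r M S : ℝ}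
    (hM : 0 < M) {w : Eu d → ℝ}
    {a : Fin d → Fin d → Eu d → ℝ} (hell : UnifElliptic d ν a)
    (hc : ContinuousOn w (closedBall 0 r)) (hw : ContDiffOn ℝ 2 w (ball 0 r))
    (hS : ∀ x ∈ closedBall (0 : Eu d) r, |w x| ≤ S) :
    ENNReal.ofReal (M ^ d) *
      volume {y | y ∈ ball (0 : Eu d) r \ touch w r M ∧ 2 * S < M * (r - ‖y‖) ^ 2 / 8} ≤
      ENNReal.ofReal (11 ^ d * C3 d ν) *
      ((∫⁻ x in ball (0 : Eu d) r, (ENNReal.ofReal |Lop a w x|) ^ d) +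
        ENNReal.ofReal (M ^ d) * volume (touch w r (LamC d ν * M) \ touch w r M)) := by
  set U := {y | y ∈ ball (0 : Eu d) r \ touch w r M ∧ 2 * S < M * (r - ‖y‖) ^ 2 / 8} with hU
  have hp := fun (y : Eu d) (hy : y ∈ U) => vitali_pt hM hc hw hS hy.1 hy.2
  set T := touch w r M with hT
  set t : Eu d → ℝ := fun y => infDist y T with ht
  obtain ⟨u, huU, hdis, hcov⟩ := Vitali.exists_disjoint_subfamily_covering_enlargement_closedBall U
    (fun y => y) (fun y => 2 * t y) (2 * r) (fun y hy => by
      have := (hp y hy).2.1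
      linarith) 5 (by norm_num)
  have hcount : u.Countable := hdis.countable_of_nonempty_interior fun y hy => by
    have h0 := (hp y (huU hy)).1
    exact ((nonempty_ball (x := y)).2 (by linarith : 0 < 2 * t y)).mono
      ball_subset_interior_closedBall
  have hUsub : U ⊆ ⋃ y ∈ u, ball y (11 * t y) := by
    intro y hy
    obtain ⟨b, hb, hbs⟩ := hcov y hy
    have h0 := (hp y hy).1
    have h0' := (hp b (huU hb)).1
    have := hbs (mem_closedBall_self (by linarith : 0 ≤ 2 * t y))
    refine mem_biUnion hb ?_
    rw [mem_closedBall] at this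
    rw [mem_ball]
    have h0'' : 0 < t b := h0'
    linarith
  have hvol : ∀ y ∈ u, volume (ball y (11 * t y)) = ENNReal.ofReal (11 ^ d) * volume (ball y (t y)) := by
    intro y hy
    have h0 : 0 < t y := (hp y (huU hy)).1
    rw [vol_ball _ h0, vol_ball _ (by linarith : 0 < 11 * t y), mul_pow,
      ENNReal.ofReal_mul (by positivity), mul_assoc]
  have hmT : MeasurableSet (touch w r (LamC d ν * M) \ T) :=
    (touch_meas hw _).diff (touch_meas hw _)
  have hdis2 : ∀ (s : Eu d → ℝ), (∀ y ∈ u, s y ≤ 2 * t y) →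
      u.PairwiseDisjoint (fun y => ball y (s y)) := by
    intro s hs i hi j hj hij
    refine (hdis hi hj hij).mono ?_ ?_
    · exact (ball_subset_ball (hs i hi)).trans ball_subset_closedBall
    · exact (ball_subset_ball (hs j hj)).trans ball_subset_closedBall
  have : Countable u := hcount.to_subtype
  have s1 : ∑' y : u, ∫⁻ x in ball (y : Eu d) (2 * t y), (ENNReal.ofReal |Lop a w x|) ^ d
      ≤ ∫⁻ x in ball (0 : Eu d) r, (ENNReal.ofReal |Lop a w x|) ^ d := by
    rw [← lintegral_biUnion hcount (fun _ _ => measurableSet_ball) (hdis2 _ fun _ _ => le_rfl)]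
    exact lintegral_mono_set (iUnion₂_subset fun y hy => (hp y (huU hy)).2.2.1)
  have s2 : ∑' y : u, volume (touch w r (LamC d ν * M) ∩ ball (y : Eu d) (t y))
      ≤ volume (touch w r (LamC d ν * M) \ T) := by
    rw [← measure_biUnion hcount (f := fun y => touch w r (LamC d ν * M) ∩ ball (y : Eu d) (t y))]
    · refine measure_mono (iUnion₂_subset fun y hy z hz => ⟨hz.1, fun hzT => ?_⟩)
      exact (disjoint_left.1 (hp y (huU hy)).2.2.2.2) hz.2 hzT
    · intro i hi j hj hij
      exact (hdis2 t (fun y hy => by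
        have h0 : 0 < t y := (hp y (huU hy)).1
        linarith) hi hj hij).mono inter_subset_right inter_subset_right
    · exact fun y _ => (touch_meas hw _).inter measurableSet_ball
  calc ENNReal.ofReal (M ^ d) * volume U
      ≤ ENNReal.ofReal (M ^ d) * ∑' y : u, volume (ball (y : Eu d) (11 * t y)) := by
        gcongr
        exact (measure_mono hUsub).trans (measure_biUnion_le _ hcount _)
    _ = ENNReal.ofReal (11 ^ d) *
          ∑' y : u, ENNReal.ofReal (M ^ d) * volume (ball (y : Eu d) (t y)) := by
        rw [← ENNReal.tsum_mul_left, ← ENNReal.tsum_mul_left]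
        refine tsum_congr fun y => ?_
        rw [hvol y y.2]; ring
    _ ≤ ENNReal.ofReal (11 ^ d) * ∑' y : u, ENNReal.ofReal (C3 d ν) *
        ((∫⁻ x in ball (y : Eu d) (2 * t y), (ENNReal.ofReal |Lop a w x|) ^ d) +
        ENNReal.ofReal (M ^ d) * volume (touch w r (LamC d ν * M) ∩ ball (y : Eu d) (t y))) := by
        refine mul_le_mul' le_rfl (ENNReal.tsum_le_tsum fun y => ?_)
        obtain ⟨h0, _, h2, ⟨x1, hx1, hx1n⟩, _⟩ := hp y (huU y.2)
        exact key_est hd hν hν1 hM h0 hell hc hw h2 hx1 hx1n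
    _ ≤ _ := by
        rw [ENNReal.tsum_mul_left, ENNReal.tsum_add, ENNReal.tsum_mul_left, ← mul_assoc,
          ← ENNReal.ofReal_mul (by positivity)]
        gcongr

lemma layer {d : ℕ} (hd : d ≠ 0) {r s : ℝ} (hr : 0 < r) (hs : 0 ≤ s) :
    volume.real {y : Eu d | y ∈ ball (0 : Eu d) r ∧ r - ‖y‖ ≤ r * s} ≤
      d * s * volume.real (ball (0 : Eu d) r) := by
  have hd1 : (1 : ℝ) ≤ d := by exact_mod_cast Nat.one_le_iff_ne_zero.2 hd
  have hV0 : 0 ≤ volume.real (ball (0 : Eu d) r) := measureReal_nonneg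
  have hfin : volume (ball (0 : Eu d) r) ≠ ⊤ := measure_ball_lt_top.ne
  by_cases h1 : 1 ≤ s
  · calc _ ≤ volume.real (ball (0 : Eu d) r) := measureReal_mono (fun y hy => hy.1) hfin
      _ ≤ _ := by
        have : 1 ≤ d * s := by nlinarith
        nlinarith
  · push Not at h1
    have hr' : 0 < r * (1 - s) := mul_pos hr (by linarith)
    have hvr : ∀ δ : ℝ, 0 < δ → volume.real (ball (0 : Eu d) δ)
        = δ ^ d * volume.real (ball (0 : Eu d) 1) := by
      intro δ hδ
      simp only [Measure.real]
      rw [vol_ball _ hδ, ENNReal.toReal_mul, ENNReal.toReal_ofReal (by positivity)]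
    have hsub : {y : Eu d | y ∈ ball (0 : Eu d) r ∧ r - ‖y‖ ≤ r * s} ⊆
        ball 0 r \ ball 0 (r * (1 - s)) := by
      rintro y ⟨hy, hy2⟩
      refine ⟨hy, fun hy3 => ?_⟩
      rw [mem_ball, dist_zero_right] at hy3
      linarith
    have hb : 1 - d * s ≤ (1 - s) ^ d := by
      have := one_add_mul_le_pow (a := -s) (by linarith) d
      calc 1 - d * s = 1 + d * (-s) := by ring
        _ ≤ _ := this
        _ = _ := by ring
    calc _ ≤ volume.real (ball (0 : Eu d) r \ ball 0 (r * (1 - s))) :=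
          measureReal_mono hsub (ne_top_of_le_ne_top hfin (measure_mono sdiff_subset))
      _ = volume.real (ball (0 : Eu d) r) - volume.real (ball (0 : Eu d) (r * (1 - s))) :=
          measureReal_sdiff (ball_subset_ball (by nlinarith)) measurableSet_ball hfin
      _ = (1 - (1 - s) ^ d) * volume.real (ball (0 : Eu d) r) := by
          rw [hvr r hr, hvr _ hr', mul_pow]; ring
      _ ≤ _ := by gcongr; linarith

lemma rec_decay {C A q V : ℝ} (hC : 1 ≤ C) (hA : 0 ≤ A) (hq0 : 0 < q) (hV : 0 ≤ V) {g : ℕ → ℝ}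
    (h0 : g 0 ≤ V) (hg : ∀ k, g (k + 1) ≤ (1 - 1 / C) * g k + A * q ^ k * V) (k : ℕ) :
    g k ≤ (1 + 2 * C * A) * (max (1 - 1 / (2 * C)) q) ^ k * V := by
  set γ := max (1 - 1 / (2 * C)) q
  have hγ0 : 0 < γ := lt_of_lt_of_le hq0 (le_max_right _ _)
  have hγ1 : 1 - 1 / (2 * C) ≤ γ := le_max_left _ _
  have hC0 : 0 < C := by linarith
  induction k with
  | zero =>
    have : 0 ≤ 2 * C * A * V := by positivity
    simp only [pow_zero, mul_one]; nlinarith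
  | succ k ih =>
    have h1 : 0 ≤ 1 - 1 / C := by
      rw [sub_nonneg, div_le_one hC0]; exact hC
    have h2 : q ^ k ≤ γ ^ k := pow_le_pow_left₀ hq0.le (le_max_right _ _) k
    have h3 : (1 - 1 / C) * (1 + 2 * C * A) + A ≤ (1 + 2 * C * A) * γ := by
      have h4 : (1 + 2 * C * A) * (1 - 1 / (2 * C)) ≤ (1 + 2 * C * A) * γ := by gcongr
      refine le_trans ?_ h4
      have : (1 + 2 * C * A) * (1 - 1 / (2 * C)) - ((1 - 1 / C) * (1 + 2 * C * A) + A)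
          = 1 / (2 * C) := by field_simp; ring
      have h5 : 0 < 1 / (2 * C) := by positivity
      linarith
    calc g (k + 1) ≤ (1 - 1 / C) * g k + A * q ^ k * V := hg k
      _ ≤ (1 - 1 / C) * ((1 + 2 * C * A) * γ ^ k * V) + A * γ ^ k * V := by gcongr
      _ = ((1 - 1 / C) * (1 + 2 * C * A) + A) * (γ ^ k * V) := by ring
      _ ≤ (1 + 2 * C * A) * γ * (γ ^ k * V) := by gcongr
      _ = _ := by ring

lemma decay {d : ℕ} (hd : d ≠ 0) {ν : ℝ} (hν : 0 < ν) (hν1 : ν ≤ 1) :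
    ∃ γ K : ℝ, 0 < γ ∧ γ < 1 ∧ 0 < K ∧ ∀ (a : Fin d → Fin d → Eu d → ℝ) (r m : ℝ) (w : Eu d → ℝ),
      UnifElliptic d ν a → 0 < r → 0 < m → ContinuousOn w (closedBall 0 r) →
      ContDiffOn ℝ 2 w (ball 0 r) → (∀ x ∈ sphere (0 : Eu d) r, w x = 0) →
      (∫⁻ x in ball (0 : Eu d) r, (ENNReal.ofReal |Lop a w x|) ^ d
        ≤ ENNReal.ofReal (m ^ d) * volume (ball (0 : Eu d) r)) →
      ∀ k : ℕ, volume (ball (0 : Eu d) r \ touch w r (m * LamC d ν ^ k)) ≤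
        ENNReal.ofReal (K * γ ^ k) * volume (ball (0 : Eu d) r) := by
  have hL := LamC_ge hd hν
  set Λ := LamC d ν with hΛ
  have hΛ0 : 0 < Λ := by linarith
  have hC3 := C3_pos hd hν
  set C := 11 ^ d * C3 d ν with hC
  have hC0 : 0 < C := by positivity
  set q := Real.sqrt (Λ⁻¹) with hq
  have hq0 : 0 < q := Real.sqrt_pos.2 (by positivity)
  have hqq : q ^ 2 = Λ⁻¹ := Real.sq_sqrt (by positivity)
  have hq1 : q < 1 := by
    have : Λ⁻¹ < 1 := inv_lt_one_of_one_lt₀ (by linarith)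
    nlinarith
  set σ := Real.sqrt (32 / ν) with hσ
  have hσ0 : 0 ≤ σ := Real.sqrt_nonneg _
  have hσσ : σ ^ 2 = 32 / ν := Real.sq_sqrt (by positivity)
  refine ⟨max (1 - 1 / (2 * (C + 1))) q, 1 + 2 * (C + 1) * (1 + d * σ), lt_of_lt_of_le hq0
    (le_max_right _ _), max_lt ?_ hq1, by positivity, ?_⟩
  · have : 0 < 1 / (2 * (C + 1)) := by positivity
    linarith
  intro a r m w hell hr hm hc hw h0 hF k
  have hfin : volume (ball (0 : Eu d) r) ≠ ⊤ := measure_ball_lt_top.ne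
  have hfin' : ∀ s ⊆ ball (0 : Eu d) r, volume s ≠ ⊤ := fun s hs =>
    ne_top_of_le_ne_top hfin (measure_mono hs)
  have hV0 : 0 ≤ volume.real (ball (0 : Eu d) r) := measureReal_nonneg
  set V := volume.real (ball (0 : Eu d) r) with hV
  set g : ℕ → ℝ := fun k => volume.real (ball (0 : Eu d) r \ touch w r (m * Λ ^ k)) with hg
  have hrec : ∀ k, g (k + 1) ≤ (1 - 1 / (C + 1)) * g k + (1 + d * σ) * q ^ k * V := by
    intro k
    have hM : 0 < m * Λ ^ k := by positivity
    have hvit := vitali_step hd hν hν1 hM hell hc hw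
      (fun x hx => abp hd hν hell hr hm hc hw h0 hF hx)
    set M := m * Λ ^ k with hMdef
    set U := {y | y ∈ ball (0 : Eu d) r \ touch w r M ∧
      2 * (2 * m * r ^ 2 / ν) < M * (r - ‖y‖) ^ 2 / 8} with hU
    have hTs : LamC d ν * M = m * Λ ^ (k + 1) := by rw [hMdef, pow_succ, ← hΛ]; ring
    rw [hTs] at hvit
    have hdiff : volume.real (touch w r (m * Λ ^ (k + 1)) \ touch w r M) = g k - g (k + 1) := by
      have e : touch w r (m * Λ ^ (k + 1)) \ touch w r M =
          (ball (0 : Eu d) r \ touch w r M) \ (ball (0 : Eu d) r \ touch w r (m * Λ ^ (k + 1))) := by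
        ext x
        have : x ∈ touch w r (m * Λ ^ (k + 1)) → x ∈ ball (0 : Eu d) r := fun h => h.1
        simp only [Set.mem_sdiff]; tauto
      rw [e, measureReal_sdiff _ (measurableSet_ball.diff (touch_meas hw _))
        (hfin' _ sdiff_subset)]
      refine sdiff_subset_sdiff_right (touch_mono ?_)
      rw [← hTs, ← hΛ]; nlinarith
    have hdn : 0 ≤ g k - g (k + 1) := hdiff ▸ measureReal_nonneg
    -- real version
    have hreal : M ^ d * volume.real U ≤ C * (m ^ d * V + M ^ d * (g k - g (k + 1))) := by
      have h2 : ENNReal.ofReal (M ^ d) * volume U ≤ ENNReal.ofReal C *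
          (ENNReal.ofReal (m ^ d) * volume (ball (0 : Eu d) r) +
            ENNReal.ofReal (M ^ d) * volume (touch w r (m * Λ ^ (k + 1)) \ touch w r M)) := by
        refine hvit.trans ?_
        gcongr
      have hf3 : volume (touch w r (m * Λ ^ (k + 1)) \ touch w r M) ≠ ⊤ :=
        hfin' _ (fun x hx => hx.1.1)
      have h3 := ENNReal.toReal_mono (by finiteness) h2
      rw [ENNReal.toReal_mul, ENNReal.toReal_mul, ENNReal.toReal_add (by finiteness) (by finiteness),
        ENNReal.toReal_mul, ENNReal.toReal_mul, ENNReal.toReal_ofReal (by positivity),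
        ENNReal.toReal_ofReal (by positivity), ENNReal.toReal_ofReal (by positivity)] at h3
      rw [← hdiff]
      exact h3
    have hMm : m ^ d ≤ M ^ d * q ^ k := by
      have h4 : (1 : ℝ) ≤ Λ ^ k := one_le_pow₀ (by linarith)
      have h5 : Λ ^ k ≤ (Λ ^ k) ^ d := le_self_pow₀ h4 hd
      have h6 : 1 ≤ Λ ^ k * q ^ k := by
        rw [← mul_pow]
        apply one_le_pow₀
        have : Λ * q ^ 2 = 1 := by rw [hqq]; field_simp
        nlinarith
      rw [hMdef, mul_pow]
      have h7 : 1 ≤ (Λ ^ k) ^ d * q ^ k := h6.trans (by gcongr)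
      calc m ^ d = m ^ d * 1 := by ring
        _ ≤ m ^ d * ((Λ ^ k) ^ d * q ^ k) := by gcongr
        _ = _ := by ring
    have hUle : volume.real U ≤ C * (q ^ k * V + (g k - g (k + 1))) := by
      have hMd : 0 < M ^ d := by positivity
      refine le_of_mul_le_mul_left ?_ hMd
      calc _ ≤ C * (m ^ d * V + M ^ d * (g k - g (k + 1))) := hreal
        _ ≤ C * (M ^ d * q ^ k * V + M ^ d * (g k - g (k + 1))) := by gcongr
        _ = _ := by ring
    have hlay := layer hd hr (s := σ * q ^ k) (by positivity)
    have hgk : g k ≤ volume.real U + d * (σ * q ^ k) * V := by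
      have hsub : ball (0 : Eu d) r \ touch w r M ⊆
          U ∪ {y : Eu d | y ∈ ball (0 : Eu d) r ∧ r - ‖y‖ ≤ r * (σ * q ^ k)} := by
        intro y hy
        by_cases hy2 : 2 * (2 * m * r ^ 2 / ν) < M * (r - ‖y‖) ^ 2 / 8
        · exact Or.inl ⟨hy, hy2⟩
        · refine Or.inr ⟨hy.1, ?_⟩
          push Not at hy2
          apply le_of_sq_le_sq _ (by positivity)
          have h8 : (r * (σ * q ^ k)) ^ 2 = r ^ 2 * (32 / ν) * (Λ⁻¹) ^ k := by
            rw [mul_pow, mul_pow, hσσ, ← pow_mul, mul_comm k 2, pow_mul, hqq]; ring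
          rw [h8]
          have h9 : M * (r - ‖y‖) ^ 2 ≤ M * (r ^ 2 * (32 / ν) * (Λ⁻¹) ^ k) := by
            have : M * (r ^ 2 * (32 / ν) * (Λ⁻¹) ^ k) = 8 * (2 * (2 * m * r ^ 2 / ν)) := by
              rw [hMdef, inv_pow]; field_simp; norm_num
            linarith
          exact le_of_mul_le_mul_left h9 hM
      calc g k ≤ volume.real (U ∪ {y : Eu d | y ∈ ball (0 : Eu d) r ∧ r - ‖y‖ ≤ r * (σ * q ^ k)}) :=
            measureReal_mono hsub (hfin' _ (union_subset (fun y hy => hy.1.1) fun y hy => hy.1))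
        _ ≤ _ := (measureReal_union_le _ _).trans (by gcongr)
    have hfinal : g k ≤ (C + 1) * (q ^ k * V + (g k - g (k + 1))) + d * (σ * q ^ k) * V := by
      have : 0 ≤ q ^ k * V := by positivity
      nlinarith
    have hC1 : 0 < C + 1 := by linarith
    refine le_of_mul_le_mul_left ?_ hC1
    have e : (C + 1) * ((1 - 1 / (C + 1)) * g k + (1 + d * σ) * q ^ k * V)
        = C * g k + (C + 1) * (1 + d * σ) * (q ^ k * V) := by field_simp; ring
    rw [e]
    have : 0 ≤ C * (d * σ * (q ^ k * V)) := by positivity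
    nlinarith
  have hg0 : g 0 ≤ V := measureReal_mono sdiff_subset hfin
  have := rec_decay (by linarith : 1 ≤ C + 1) (by positivity) hq0 hV0 hg0 hrec k
  have h1 : volume (ball (0 : Eu d) r \ touch w r (m * Λ ^ k)) = ENNReal.ofReal (g k) :=
    (ENNReal.ofReal_toReal (hfin' _ sdiff_subset)).symm
  have h2 : volume (ball (0 : Eu d) r) = ENNReal.ofReal V := (ENNReal.ofReal_toReal hfin).symm
  rw [h1, h2, ← ENNReal.ofReal_mul (by positivity)]
  exact ENNReal.ofReal_le_ofReal this

lemma hessNorm_nonneg' {d : ℕ} (w : Eu d → ℝ) (x : Eu d) : 0 ≤ hessNorm w x := Real.sqrt_nonneg _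

lemma young_pow {d : ℕ} (hd : d ≠ 0) {ε m f : ℝ} (hε : 0 < ε) (hε1 : ε ≤ 1) (hm : 0 < m)
    (hf : 0 ≤ f) : f ^ ε ≤ m ^ ε + m ^ ε / m ^ d * f ^ d := by
  have hmε : 0 < m ^ ε := Real.rpow_pos_of_pos hm _
  by_cases h : f ≤ m
  · have h1 : f ^ ε ≤ m ^ ε := Real.rpow_le_rpow hf h hε.le
    have : 0 ≤ m ^ ε / m ^ d * f ^ d := by positivity
    linarith
  · push Not at h
    have h1 : 1 ≤ f / m := by rw [one_le_div hm]; exact h.le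
    have h2 : (f / m) ^ ε ≤ (f / m) ^ (d : ℝ) := by
      apply Real.rpow_le_rpow_of_exponent_le h1
      have : (1 : ℝ) ≤ d := by exact_mod_cast Nat.one_le_iff_ne_zero.2 hd
      linarith
    rw [Real.div_rpow hf hm.le, Real.rpow_natCast, div_pow, div_le_iff₀ hmε] at h2
    have : m ^ ε / m ^ d * f ^ d = f ^ d / m ^ d * m ^ ε := by ring
    linarith

lemma exists_eps {Λ γ : ℝ} (hΛ : 0 < Λ) (hγ1 : γ < 1) :
    ∃ ε : ℝ, 0 < ε ∧ ε ≤ 1 ∧ Λ ^ ε * γ < 1 := by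
  have hcont : ContinuousAt (fun ε : ℝ => Λ ^ ε * γ) 0 :=
    (Real.continuousAt_const_rpow hΛ.ne').mul continuousAt_const
  have h1 : ∀ᶠ ε in 𝓝 (0 : ℝ), Λ ^ ε * γ < 1 := by
    apply hcont.eventually_lt continuousAt_const
    simpa using hγ1
  have h2 : ∀ᶠ ε in 𝓝[>] (0 : ℝ), (Λ ^ ε * γ < 1 ∧ ε ∈ Ioo (0 : ℝ) 1) :=
    (h1.filter_mono nhdsWithin_le_nhds).and (Ioo_mem_nhdsGT one_pos)
  obtain ⟨ε, he, he2⟩ := h2.exists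
  exact ⟨ε, he2.1, he2.2.le, he⟩

lemma pre_final {d : ℕ} (hd : d ≠ 0) {ν : ℝ} (hν : 0 < ν) (hν1 : ν ≤ 1) :
    ∃ ε N : ℝ, 0 < ε ∧ ε ≤ 1 ∧ 0 < N ∧
      ∀ (a : Fin d → Fin d → Eu d → ℝ) (r m : ℝ) (w : Eu d → ℝ),
      UnifElliptic d ν a → 0 < r → 0 < m → ContinuousOn w (closedBall 0 r) →
      ContDiffOn ℝ 2 w (ball 0 r) → (∀ x ∈ sphere (0 : Eu d) r, w x = 0) →
      (∫⁻ x in ball (0 : Eu d) r, (ENNReal.ofReal |Lop a w x|) ^ d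
        ≤ ENNReal.ofReal (m ^ d) * volume (ball (0 : Eu d) r)) →
      ∫⁻ x in ball (0 : Eu d) r, ENNReal.ofReal (hessNorm w x ^ ε) ≤
        ENNReal.ofReal (N * m ^ ε) * volume (ball (0 : Eu d) r) := by
  obtain ⟨γ, K, hγ0, hγ1, hK, hdecay⟩ := decay hd hν hν1
  have hL := LamC_ge hd hν
  set Λ := LamC d ν with hΛ
  have hΛ0 : 0 < Λ := by linarith
  obtain ⟨ε, hε0, hε1, hεγ⟩ := exists_eps hΛ0 hγ1
  have hΛε : 0 < Λ ^ ε := Real.rpow_pos_of_pos hΛ0 _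
  set θ := Λ ^ ε * γ with hθ
  have hθ0 : 0 < θ := by positivity
  set C2 : ℝ := d * (ν⁻¹ + ν⁻¹ * (d * ν⁻¹) + 1) with hC2
  have hd0 : (0 : ℝ) < d := by exact_mod_cast Nat.pos_of_ne_zero hd
  have hC20 : 0 < C2 := by positivity
  have hC2ε : 0 < C2 ^ ε := Real.rpow_pos_of_pos hC20 _
  have h1θ : 0 < 1 - θ := by linarith
  refine ⟨ε, C2 ^ ε * (3 + Λ ^ ε * K * (1 - θ)⁻¹), hε0, hε1, by positivity, ?_⟩
  intro a r m w hell hr hm hc hw h0 hF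
  have hdec := hdecay a r m w hell hr hm hc hw h0 hF
  have hmε : 0 < m ^ ε := Real.rpow_pos_of_pos hm _
  set B := ball (0 : Eu d) r with hB
  have hfin : volume B ≠ ⊤ := measure_ball_lt_top.ne
  have hnull : volume (⋂ k : ℕ, B \ touch w r (m * Λ ^ k)) = 0 := by
    have ht : Tendsto (fun k : ℕ => ENNReal.ofReal (K * γ ^ k) * volume B) atTop (𝓝 0) := by
      have h1 : Tendsto (fun k : ℕ => K * γ ^ k) atTop (𝓝 (K * 0)) :=
        (tendsto_pow_atTop_nhds_zero_of_lt_one hγ0.le hγ1).const_mul K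
      have h2 := ENNReal.Tendsto.mul_const (b := volume B) (ENNReal.tendsto_ofReal h1) (Or.inr hfin)
      simpa using h2
    refine le_antisymm (ge_of_tendsto' ht fun k => ?_) zero_le
    exact (measure_mono (iInter_subset _ k)).trans (hdec k)
  set G : Eu d → ENNReal := fun x => ∑' k : ℕ,
    (B \ touch w r (m * Λ ^ k)).indicator (fun _ => ENNReal.ofReal ((m * Λ ^ (k + 1)) ^ ε)) x with hG
  have hmeas : ∀ k : ℕ, MeasurableSet (B \ touch w r (m * Λ ^ k)) := fun k =>
    measurableSet_ball.diff (touch_meas hw _)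
  have hGm : Measurable G := by
    refine Measurable.ennreal_tsum fun k => ?_
    exact measurable_const.indicator (hmeas k)
  -- hess bound
  have hbd : ∀ x M, 0 < M → x ∈ touch w r M → ENNReal.ofReal (hessNorm w x ^ ε) ≤
      ENNReal.ofReal (C2 ^ ε) * (ENNReal.ofReal (M ^ ε) + (ENNReal.ofReal (m ^ ε) +
        ENNReal.ofReal (m ^ ε / m ^ d) * (ENNReal.ofReal |Lop a w x|) ^ d)) := by
    intro x M hM hx
    have h1 := touch_hess hν hell hM hw hx
    have hf := abs_nonneg (Lop a w x)
    have h2 : hessNorm w x ^ ε ≤ C2 ^ ε * (M ^ ε + (m ^ ε + m ^ ε / m ^ d * |Lop a w x| ^ d)) := by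
      calc hessNorm w x ^ ε ≤ (C2 * (M + |Lop a w x|)) ^ ε :=
            Real.rpow_le_rpow (hessNorm_nonneg' w x) h1 hε0.le
        _ = C2 ^ ε * (M + |Lop a w x|) ^ ε := Real.mul_rpow hC20.le (by positivity)
        _ ≤ C2 ^ ε * (M ^ ε + |Lop a w x| ^ ε) := by
            gcongr
            exact Real.rpow_add_le_add_rpow hM.le hf hε0.le hε1
        _ ≤ _ := by
            gcongr
            exact young_pow hd hε0 hε1 hm hf
    have hMε : 0 < M ^ ε := Real.rpow_pos_of_pos hM _
    refine (ENNReal.ofReal_le_ofReal h2).trans (le_of_eq ?_)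
    rw [ENNReal.ofReal_mul hC2ε.le, ENNReal.ofReal_add hMε.le (by positivity),
      ENNReal.ofReal_add hmε.le (by positivity), ENNReal.ofReal_mul (by positivity),
      ENNReal.ofReal_pow hf]
  have hpt : ∀ᵐ x ∂volume.restrict B, ENNReal.ofReal (hessNorm w x ^ ε) ≤
      ENNReal.ofReal (C2 ^ ε) * ((ENNReal.ofReal (2 * m ^ ε) + G x) +
        ENNReal.ofReal (m ^ ε / m ^ d) * (ENNReal.ofReal |Lop a w x|) ^ d) := by
    rw [ae_restrict_iff' measurableSet_ball]
    have : ∀ᵐ x ∂(volume : Measure (Eu d)), x ∉ ⋂ k : ℕ, B \ touch w r (m * Λ ^ k) :=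
      measure_eq_zero_iff_ae_notMem.1 hnull
    filter_upwards [this] with x hx hxB
    have hex : ∃ k : ℕ, x ∈ touch w r (m * Λ ^ k) := by
      by_contra hno
      push Not at hno
      exact hx (mem_iInter.2 fun k => ⟨hxB, hno k⟩)
    classical
    have hk := Nat.find_spec hex
    have hkm := fun j => Nat.find_min hex (m := j)
    have h2 : ENNReal.ofReal (2 * m ^ ε) = ENNReal.ofReal (m ^ ε) + ENNReal.ofReal (m ^ ε) := by
      rw [two_mul, ENNReal.ofReal_add hmε.le hmε.le]
    rw [h2]
    cases hfk : Nat.find hex with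
    | zero =>
      rw [hfk, pow_zero, mul_one] at hk
      refine (hbd x m hm hk).trans ?_
      refine mul_le_mul' le_rfl ?_
      rw [← add_assoc]
      exact add_le_add le_self_add le_rfl
    | succ j =>
      rw [hfk] at hk hkm
      have hj := hkm j (Nat.lt_succ_self j)
      refine (hbd x _ (by positivity) hk).trans ?_
      have hGx : ENNReal.ofReal ((m * Λ ^ (j + 1)) ^ ε) ≤ G x := by
        refine le_trans (le_of_eq ?_) (ENNReal.le_tsum j)
        rw [indicator_of_mem (show x ∈ B \ touch w r (m * Λ ^ j) from ⟨hxB, hj⟩)]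
      refine mul_le_mul' le_rfl ?_
      rw [← add_assoc]
      refine add_le_add ?_ le_rfl
      rw [add_comm]
      exact add_le_add le_self_add hGx
  have hGint : ∫⁻ x in B, G x ≤ ENNReal.ofReal (Λ ^ ε * K * (1 - θ)⁻¹ * m ^ ε) * volume B := by
    rw [lintegral_tsum (fun k => (measurable_const.indicator (hmeas k)).aemeasurable)]
    have hs : HasSum (fun k : ℕ => Λ ^ ε * K * m ^ ε * θ ^ k) (Λ ^ ε * K * m ^ ε * (1 - θ)⁻¹) :=
      (hasSum_geometric_of_lt_one hθ0.le hεγ).mul_left _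
    have e : Λ ^ ε * K * (1 - θ)⁻¹ * m ^ ε = ∑' k : ℕ, Λ ^ ε * K * m ^ ε * θ ^ k := by
      rw [hs.tsum_eq]; ring
    rw [e, ENNReal.ofReal_tsum_of_nonneg (fun k => by positivity) hs.summable,
      ← ENNReal.tsum_mul_right]
    refine ENNReal.tsum_le_tsum fun k => ?_
    rw [lintegral_indicator_const (hmeas k)]
    have e2 : Λ ^ ε * K * m ^ ε * θ ^ k = (m * Λ ^ (k + 1)) ^ ε * (K * γ ^ k) := by
      rw [hθ, Real.mul_rpow hm.le (by positivity), ← Real.rpow_natCast Λ, ← Real.rpow_mul hΛ0.le,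
        mul_comm ((k + 1 : ℕ) : ℝ) ε, Real.rpow_mul hΛ0.le, Real.rpow_natCast]
      ring
    rw [e2, ENNReal.ofReal_mul (by positivity), mul_assoc]
    gcongr
    exact (Measure.restrict_apply_le _ _).trans (hdec k)
  calc ∫⁻ x in B, ENNReal.ofReal (hessNorm w x ^ ε)
      ≤ ∫⁻ x in B, ENNReal.ofReal (C2 ^ ε) * ((ENNReal.ofReal (2 * m ^ ε) + G x) +
        ENNReal.ofReal (m ^ ε / m ^ d) * (ENNReal.ofReal |Lop a w x|) ^ d) := lintegral_mono_ae hpt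
    _ = ENNReal.ofReal (C2 ^ ε) * ((ENNReal.ofReal (2 * m ^ ε) * volume B + ∫⁻ x in B, G x) +
        ENNReal.ofReal (m ^ ε / m ^ d) * ∫⁻ x in B, (ENNReal.ofReal |Lop a w x|) ^ d) := by
        rw [lintegral_const_mul' _ _ ENNReal.ofReal_ne_top,
          lintegral_add_left (f := fun x => ENNReal.ofReal (2 * m ^ ε) + G x)
            (measurable_const.add hGm),
          lintegral_add_left measurable_const, setLIntegral_const,
          lintegral_const_mul' _ _ ENNReal.ofReal_ne_top]
    _ ≤ ENNReal.ofReal (C2 ^ ε) * ((ENNReal.ofReal (2 * m ^ ε) * volume B +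
          ENNReal.ofReal (Λ ^ ε * K * (1 - θ)⁻¹ * m ^ ε) * volume B) +
        ENNReal.ofReal (m ^ ε / m ^ d) * (ENNReal.ofReal (m ^ d) * volume B)) := by
        gcongr
    _ = _ := by
        rw [← mul_assoc (ENNReal.ofReal (m ^ ε / m ^ d)), ← ENNReal.ofReal_mul (by positivity),
          div_mul_cancel₀ _ (by positivity), ← add_mul, ← add_mul,
          ← ENNReal.ofReal_add (by positivity) (by positivity),
          ← ENNReal.ofReal_add (by positivity) (by positivity), ← mul_assoc,
          ← ENNReal.ofReal_mul (by positivity)]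
        congr 2; ring

end LinHelpers

/-- **Lemma 3.1** (F. Lin's `W²_ε` estimate): there exist `ε ∈ (0,1]` and `N`, depending
only on `d` and `ν`, such that for any `w` vanishing on `∂B_r`,
`⨍_{B_r} |D²w|^ε ≤ N (⨍_{B_r} |a^{ij} D_{ij} w|^d)^{ε/d}`. -/
theorem lin_W2_epsilon_estimate (d : ℕ) (ν : ℝ) (hd : 2 ≤ d) (hν : ν ∈ Ioc (0 : ℝ) 1) :
    ∃ ε : ℝ, ε ∈ Ioc (0 : ℝ) 1 ∧ ∃ N : ℝ, 0 < N ∧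
      ∀ (a : Fin d → Fin d → EuclideanSpace ℝ (Fin d) → ℝ) (r : ℝ)
        (w : EuclideanSpace ℝ (Fin d) → ℝ),
        (∀ i j, Measurable (a i j)) →
        (∀ i j x, a i j x = a j i x) →
        UnifElliptic d ν a →
        0 < r →
        ContinuousOn w (closedBall (0 : EuclideanSpace ℝ (Fin d)) r) →
        ContDiffOn ℝ 2 w (ball (0 : EuclideanSpace ℝ (Fin d)) r) →
        IntegrableOn (fun x => hessNorm w x) (ball (0 : EuclideanSpace ℝ (Fin d)) r) →
        (∀ x ∈ sphere (0 : EuclideanSpace ℝ (Fin d)) r, w x = 0) →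
        (∫⁻ x in ball (0 : EuclideanSpace ℝ (Fin d)) r,
            ENNReal.ofReal (hessNorm w x ^ ε))
            / volume (ball (0 : EuclideanSpace ℝ (Fin d)) r)
          ≤ ENNReal.ofReal N *
            ((∫⁻ x in ball (0 : EuclideanSpace ℝ (Fin d)) r,
                ENNReal.ofReal (|∑ i, ∑ j, a i j x * pd2 i j w x| ^ (d : ℝ)))
                / volume (ball (0 : EuclideanSpace ℝ (Fin d)) r)) ^ (ε / (d : ℝ)) := by
  have hd0 : d ≠ 0 := by omega
  have hdR : (0 : ℝ) < d := by exact_mod_cast Nat.pos_of_ne_zero hd0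
  obtain ⟨ε, N, hε0, hε1, hN, hmain⟩ := pre_final hd0 hν.1 hν.2
  refine ⟨ε, ⟨hε0, hε1⟩, N, hN, ?_⟩
  intro a r w _ _ hell hr hc hw _ h0
  have hV0 : volume (ball (0 : EuclideanSpace ℝ (Fin d)) r) ≠ 0 := (measure_ball_pos _ _ hr).ne'
  have hVt : volume (ball (0 : EuclideanSpace ℝ (Fin d)) r) ≠ ⊤ := measure_ball_lt_top.ne
  have hconv : (∫⁻ x in ball (0 : EuclideanSpace ℝ (Fin d)) r,
      ENNReal.ofReal (|∑ i, ∑ j, a i j x * pd2 i j w x| ^ (d : ℝ)))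
      = ∫⁻ x in ball (0 : EuclideanSpace ℝ (Fin d)) r, (ENNReal.ofReal |Lop a w x|) ^ d := by
    refine lintegral_congr fun x => ?_
    rw [Real.rpow_natCast, ENNReal.ofReal_pow (abs_nonneg _)]
    rfl
  rw [hconv]
  have hεd : 0 < ε / (d : ℝ) := by positivity
  set X := (∫⁻ x in ball (0 : EuclideanSpace ℝ (Fin d)) r, (ENNReal.ofReal |Lop a w x|) ^ d)
    / volume (ball (0 : EuclideanSpace ℝ (Fin d)) r) with hX
  by_cases hXt : X = ⊤
  · rw [hXt, ENNReal.top_rpow_of_pos hεd, ENNReal.mul_top (by simpa using hN)]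
    exact le_top
  have hstep : ∀ δ : ℝ, 0 < δ → (∫⁻ x in ball (0 : EuclideanSpace ℝ (Fin d)) r,
      ENNReal.ofReal (hessNorm w x ^ ε)) / volume (ball (0 : EuclideanSpace ℝ (Fin d)) r)
      ≤ ENNReal.ofReal (N * (X.toReal + δ) ^ (ε / (d : ℝ))) := by
    intro δ hδ
    have hp : 0 < X.toReal + δ := add_pos_of_nonneg_of_pos ENNReal.toReal_nonneg hδ
    have hm : 0 < (X.toReal + δ) ^ (1 / (d : ℝ)) := Real.rpow_pos_of_pos hp _
    have e1 : ((X.toReal + δ) ^ (1 / (d : ℝ))) ^ d = X.toReal + δ := by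
      rw [← Real.rpow_natCast, ← Real.rpow_mul hp.le, one_div_mul_cancel hdR.ne', Real.rpow_one]
    have e2 : ((X.toReal + δ) ^ (1 / (d : ℝ))) ^ ε = (X.toReal + δ) ^ (ε / (d : ℝ)) := by
      rw [← Real.rpow_mul hp.le]; congr 1; ring
    have h1 := hmain a r _ w hell hr hm hc hw h0 (by
      rw [e1, ← ENNReal.div_le_iff hV0 hVt, ← hX]
      refine (ENNReal.ofReal_toReal hXt).symm.le.trans (ENNReal.ofReal_le_ofReal (by linarith)))
    rw [e2] at h1
    exact (ENNReal.div_le_iff hV0 hVt).2 h1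
  have hX' : ENNReal.ofReal N * X ^ (ε / (d : ℝ))
      = ENNReal.ofReal (N * (X.toReal + 0) ^ (ε / (d : ℝ))) := by
    rw [add_zero, ENNReal.ofReal_mul hN.le,
      ← ENNReal.ofReal_rpow_of_nonneg ENNReal.toReal_nonneg hεd.le, ENNReal.ofReal_toReal hXt]
  rw [hX']
  have hcont : Continuous (fun δ : ℝ => ENNReal.ofReal (N * (X.toReal + δ) ^ (ε / (d : ℝ)))) :=
    ENNReal.continuous_ofReal.comp (continuous_const.mul
      ((Real.continuous_rpow_const hεd.le).comp (continuous_const.add continuous_id)))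
  exact ge_of_tendsto ((hcont.tendsto 0).mono_left (nhdsWithin_le_nhds (s := Ioi (0 : ℝ))))
    (eventually_mem_nhdsWithin.mono fun δ hδ => hstep δ hδ)
end
end
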